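/- arXiv:1606.02044 — 5 statements merged into one kernel-verified Lean document; each statement's English description precedes it below -/
import Mathlib

section
/- Let m ≥ 1 be an integer and let a > −1 be a real number. Then for every complex number s ≠ 1, ζ(s) = (1/(m(s−1))) Σ_{n=1}^{m} (a+n)^{1−s} + (1/m) Σ_{n=0}^∞ (−1)^n N_{n+1,m}(a) Σ_{k=0}^n (−1)^k C(n,k) (k+1)^{−s}, the outer series on the right being convergent. -/
open Filter Finset intervalIntegral

/-- The polynomials `N_{n,m}(a) = ∫_a^{a+m} x(x−1)(x−2)⋯(x−n+1)/n! dx`. -/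
noncomputable def serN (n m : ℕ) (a : ℝ) : ℝ :=
  ∫ x in a..(a + (m : ℝ)), (∏ i ∈ Finset.range n, (x - (i : ℝ))) / (n.factorial : ℝ)

open MeasureTheory Set Topology

/-- The `n`-th alternating difference `∑ₖ (-1)ᵏ C(n,k) (k+p+1)⁻ˢ`. -/
noncomputable def altDiff (n p : ℕ) (s : ℂ) : ℂ :=
  ∑ k ∈ Finset.range (n + 1), (-1) ^ k * (n.choose k : ℂ) * ((k : ℂ) + p + 1) ^ (-s)

/-- The kernel `u^{p+1} (1-u)^n` at `u = exp (-t)`, whose Mellin transform is `Γ(s) altDiff n p s`. -/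
noncomputable def expKernel (n p : ℕ) (t : ℝ) : ℝ :=
  Real.exp (-t) ^ (p + 1) * (1 - Real.exp (-t)) ^ n

lemma expKernel_nonneg (n p : ℕ) {t : ℝ} (ht : 0 < t) : 0 ≤ expKernel n p t := by
  have : Real.exp (-t) ≤ 1 := by simpa using ht.le
  have : 0 ≤ 1 - Real.exp (-t) := by linarith
  unfold expKernel
  positivity

lemma continuous_expKernel (n p : ℕ) : Continuous (expKernel n p) := by
  unfold expKernel
  fun_prop

lemma mellin_expKernel (n p : ℕ) {s : ℂ} (hs : 0 < s.re) :
    mellin (fun t => (expKernel n p t : ℂ)) s = Complex.Gamma s * altDiff n p s := by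
  have h := hasSum_mellin (ι := Fin (n + 1)) (a := fun k => (-1) ^ (k : ℕ) * (n.choose k : ℂ))
    (p := fun k => (k : ℝ) + p + 1) (F := fun t => (expKernel n p t : ℂ)) (s := s)
    (fun k => Or.inr (by positivity)) hs (fun t _ => ?_) (Summable.of_finite)
  · rw [← h.tsum_eq, tsum_fintype, altDiff, Finset.mul_sum, Finset.sum_range]
    refine Finset.sum_congr rfl fun k _ => ?_
    rw [Complex.cpow_neg]
    push_cast
    ring
  · convert hasSum_fintype _ using 1
    rw [expKernel, ← Complex.ofReal_one, sub_eq_neg_add, add_pow, Finset.mul_sum,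
      Finset.sum_range, Complex.ofReal_sum]
    refine Finset.sum_congr rfl fun k _ => ?_
    have : Real.exp (-((k : ℝ) + p + 1) * t) =
        Real.exp (-t) ^ (p + 1) * Real.exp (-t) ^ (k : ℕ) := by
      rw [← pow_add, ← Real.exp_nat_mul]
      congr 1
      push_cast
      ring
    rw [this, neg_pow]
    push_cast
    ring

lemma choose_mul_pow_mul_one_sub_pow_le_one (n p : ℕ) {u : ℝ} (h0 : 0 ≤ u) (h1 : u ≤ 1) :
    ((n + p).choose p : ℝ) * u ^ p * (1 - u) ^ n ≤ 1 := by
  have h := add_pow u (1 - u) (n + p)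
  rw [add_sub_cancel, one_pow] at h
  have h2 : 0 ≤ 1 - u := by linarith
  calc ((n + p).choose p : ℝ) * u ^ p * (1 - u) ^ n
      = u ^ p * (1 - u) ^ (n + p - p) * ((n + p).choose p : ℝ) := by
        rw [Nat.add_sub_cancel]; ring
    _ ≤ _ := Finset.single_le_sum
        (f := fun k => u ^ k * (1 - u) ^ (n + p - k) * ((n + p).choose k : ℝ))
        (fun k _ => by positivity) (by simp)
    _ = 1 := h.symm

lemma choose_mul_expKernel_le (n p : ℕ) {δ t : ℝ} (hδ : 0 ≤ δ) (hδ1 : δ ≤ 1) (ht : 0 < t) :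
    ((n + p).choose p : ℝ) * expKernel n p t ≤
      ((p : ℝ) + 1) * ((n : ℝ) + 1) ^ (-(1 - δ)) * Real.exp (-(δ * t)) := by
  set u := Real.exp (-t) with hu
  have u0 : 0 < u := Real.exp_pos _
  have u1 : u ≤ 1 := by simpa [hu] using ht.le
  have u2 : 0 ≤ 1 - u := by linarith
  set x := ((n + p).choose p : ℝ) * u ^ p * (1 - u) ^ n with hx
  have x0 : 0 ≤ x := by positivity
  have x1 : x ≤ 1 := choose_mul_pow_mul_one_sub_pow_le_one n p u0.le u1
  have hch : ((n + p + 1 : ℕ) : ℝ) * ((n + p).choose p : ℝ) =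
      ((n + (p + 1)).choose (p + 1) : ℝ) * ((p : ℝ) + 1) := by
    exact_mod_cast Nat.add_one_mul_choose_eq (n + p) p
  have x2 : x * u * ((n : ℝ) + 1) ≤ p + 1 := by
    have h := choose_mul_pow_mul_one_sub_pow_le_one n (p + 1) u0.le u1
    push_cast at hch
    calc x * u * ((n : ℝ) + 1) ≤ x * u * ((n : ℝ) + p + 1) := by gcongr; simp
      _ = (((n : ℝ) + p + 1) * ((n + p).choose p : ℝ)) * u ^ (p + 1) * (1 - u) ^ n := by
        rw [hx]; ring
      _ = (((n + (p + 1)).choose (p + 1) : ℝ) * u ^ (p + 1) * (1 - u) ^ n) * (p + 1) := by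
        rw [hch]; ring
      _ ≤ 1 * (p + 1) := by gcongr
      _ = p + 1 := one_mul _
  have n0 : (0 : ℝ) < n + 1 := by positivity
  have x3 : x ≤ (((p : ℝ) + 1) / ((n + 1) * u)) ^ (1 - δ) := by
    calc x = x ^ (1 : ℝ) := (Real.rpow_one x).symm
      _ ≤ x ^ (1 - δ) := Real.rpow_le_rpow_of_exponent_ge' x0 x1 (by linarith) (by linarith)
      _ ≤ _ := by
        refine Real.rpow_le_rpow x0 ?_ (by linarith)
        rw [le_div_iff₀ (by positivity)]
        linarith
  have x4 : ((p : ℝ) + 1) ^ (1 - δ) ≤ p + 1 := by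
    calc ((p : ℝ) + 1) ^ (1 - δ) ≤ ((p : ℝ) + 1) ^ (1 : ℝ) :=
          Real.rpow_le_rpow_of_exponent_le (by linarith [p.cast_nonneg (α := ℝ)]) (by linarith)
      _ = _ := Real.rpow_one _
  have x5 : Real.exp (-(δ * t)) = u ^ (-(1 - δ)) * u := by
    rw [hu, ← Real.exp_mul, ← Real.exp_add]
    congr 1
    ring
  calc ((n + p).choose p : ℝ) * expKernel n p t = x * u := by rw [expKernel, hx]; ring
    _ ≤ (((p : ℝ) + 1) / ((n + 1) * u)) ^ (1 - δ) * u := by gcongr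
    _ = ((p : ℝ) + 1) ^ (1 - δ) * ((n : ℝ) + 1) ^ (-(1 - δ)) * (u ^ (-(1 - δ)) * u) := by
      rw [Real.div_rpow (by positivity) (by positivity), Real.mul_rpow n0.le u0.le,
        Real.rpow_neg n0.le, Real.rpow_neg u0.le]
      field_simp
    _ ≤ _ := by rw [← x5]; gcongr

lemma integrableOn_rpow_mul_exp_neg {σ r : ℝ} (hσ : 0 < σ) (hr : 0 < r) :
    IntegrableOn (fun t : ℝ => t ^ (σ - 1) * Real.exp (-(r * t))) (Ioi 0) := by
  simpa [neg_mul] using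
    integrableOn_rpow_mul_exp_neg_mul_rpow (s := σ - 1) (p := 1) (by linarith) one_pos hr

lemma norm_cpow_mul_expKernel_le (n p : ℕ) {δ t : ℝ} (hδ : 0 ≤ δ) (hδ1 : δ ≤ 1) (ht : 0 < t)
    (s : ℂ) : ((n + p).choose p : ℝ) * ‖(t : ℂ) ^ (s - 1) * (expKernel n p t : ℂ)‖ ≤
      ((p : ℝ) + 1) * ((n : ℝ) + 1) ^ (-(1 - δ)) * (t ^ (s.re - 1) * Real.exp (-(δ * t))) := by
  rw [norm_mul, Complex.norm_cpow_eq_rpow_re_of_pos ht, Complex.norm_real, Real.norm_of_nonneg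
    (expKernel_nonneg n p ht), Complex.sub_re, Complex.one_re]
  calc _ = t ^ (s.re - 1) * (((n + p).choose p : ℝ) * expKernel n p t) := by ring
    _ ≤ t ^ (s.re - 1) * (((p : ℝ) + 1) * ((n : ℝ) + 1) ^ (-(1 - δ)) * Real.exp (-(δ * t))) := by
      exact mul_le_mul_of_nonneg_left (choose_mul_expKernel_le n p hδ hδ1 ht) (by positivity)
    _ = _ := by ring

lemma integrableOn_cpow_mul_expKernel (n p : ℕ) {s : ℂ} (hs : 0 < s.re) :
    IntegrableOn (fun t : ℝ => (t : ℂ) ^ (s - 1) * (expKernel n p t : ℂ)) (Ioi 0) := by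
  have hch : (1 : ℝ) ≤ ((n + p).choose p : ℝ) := by
    exact_mod_cast Nat.choose_pos (Nat.le_add_left p n)
  refine Integrable.mono' ((integrableOn_rpow_mul_exp_neg hs one_pos).const_mul
    (((p : ℝ) + 1) * ((n : ℝ) + 1) ^ (-(1 - 1) : ℝ))) ?_ ?_
  · refine ContinuousOn.aestronglyMeasurable (fun t ht => ?_) measurableSet_Ioi
    refine ContinuousAt.continuousWithinAt (ContinuousAt.mul ?_ ?_)
    · exact Complex.continuousAt_ofReal_cpow_const _ _ (Or.inr (ne_of_gt ht))
    · exact (Complex.continuous_ofReal.comp (continuous_expKernel n p)).continuousAt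
  · filter_upwards [ae_restrict_mem measurableSet_Ioi] with t ht
    refine le_trans ?_ (norm_cpow_mul_expKernel_le n p zero_le_one le_rfl ht s)
    exact le_mul_of_one_le_left (norm_nonneg _) hch

lemma integral_norm_cpow_mul_expKernel_le (n p : ℕ) {δ : ℝ} (hδ : 0 < δ) (hδ1 : δ ≤ 1)
    {s : ℂ} (hs : 0 < s.re) :
    ((n + p).choose p : ℝ) * ∫ t in Ioi (0 : ℝ), ‖(t : ℂ) ^ (s - 1) * (expKernel n p t : ℂ)‖ ≤
      ((p : ℝ) + 1) * ((n : ℝ) + 1) ^ (-(1 - δ)) * ((1 / δ) ^ s.re * Real.Gamma s.re) := by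
  rw [← Real.integral_rpow_mul_exp_neg_mul_Ioi hs hδ, ← MeasureTheory.integral_const_mul,
    ← MeasureTheory.integral_const_mul]
  refine setIntegral_mono_on ((integrableOn_cpow_mul_expKernel n p hs).norm.const_mul _)
    ((integrableOn_rpow_mul_exp_neg hs hδ).const_mul _) measurableSet_Ioi fun t ht => ?_
  exact norm_cpow_mul_expKernel_le n p hδ.le hδ1 ht s

lemma choose_mul_norm_altDiff_le (n p : ℕ) {δ : ℝ} (hδ : 0 < δ) (hδ1 : δ ≤ 1)
    {s : ℂ} (hs : 0 < s.re) :
    ((n + p).choose p : ℝ) * ‖altDiff n p s‖ ≤ ((p : ℝ) + 1) *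
      ((1 / δ) ^ s.re * Real.Gamma s.re / ‖Complex.Gamma s‖) * ((n : ℝ) + 1) ^ (-(1 - δ)) := by
  have hΓ : 0 < ‖Complex.Gamma s‖ := norm_pos_iff.2 (Complex.Gamma_ne_zero_of_re_pos hs)
  have h : ‖Complex.Gamma s‖ * ‖altDiff n p s‖ ≤
      ∫ t in Ioi (0 : ℝ), ‖(t : ℂ) ^ (s - 1) * (expKernel n p t : ℂ)‖ := by
    rw [← norm_mul, ← mellin_expKernel n p hs, mellin]
    exact norm_integral_le_integral_norm _
  refine le_of_mul_le_mul_left ?_ hΓ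
  calc _ = ((n + p).choose p : ℝ) * (‖Complex.Gamma s‖ * ‖altDiff n p s‖) := by ring
    _ ≤ _ := mul_le_mul_of_nonneg_left h (Nat.cast_nonneg _)
    _ ≤ _ := integral_norm_cpow_mul_expKernel_le n p hδ hδ1 hs
    _ = _ := by field_simp

lemma altDiff_succ_left (n p : ℕ) (s : ℂ) :
    altDiff (n + 1) p s =
      (p + 1) * altDiff (n + 1) p (s + 1) - (n + 1) * altDiff n (p + 1) (s + 1) := by
  have key (k : ℕ) (q : ℕ) : ((k : ℂ) + q + 1) ^ (-s) =
      ((k : ℂ) + q + 1) * ((k : ℂ) + q + 1) ^ (-(s + 1)) := by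
    have h : (k : ℂ) + q + 1 ≠ 0 := by exact_mod_cast Nat.succ_ne_zero (k + q)
    rw [neg_add, ← sub_eq_add_neg, Complex.cpow_sub _ _ h, Complex.cpow_one]
    field_simp
  have h1 : altDiff (n + 1) p s = (p + 1) * altDiff (n + 1) p (s + 1) +
      ∑ k ∈ Finset.range (n + 1 + 1), (k : ℂ) * ((-1) ^ k * ((n + 1).choose k : ℂ) *
        ((k : ℂ) + p + 1) ^ (-(s + 1))) := by
    rw [altDiff, altDiff, Finset.mul_sum, ← Finset.sum_add_distrib]
    refine Finset.sum_congr rfl fun k _ => ?_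
    rw [key k p]
    ring
  rw [h1, Finset.sum_range_succ', altDiff, altDiff, Finset.mul_sum (Finset.range (n + 1))]
  simp only [CharP.cast_eq_zero, zero_mul, add_zero, sub_eq_add_neg, ← Finset.sum_neg_distrib]
  congr 1
  refine Finset.sum_congr rfl fun k _ => ?_
  have hc : ((n : ℂ) + 1) * (n.choose k : ℂ) = ((n + 1).choose (k + 1) : ℂ) * ((k : ℂ) + 1) := by
    exact_mod_cast Nat.add_one_mul_choose_eq n k
  have e : (k : ℂ) + 1 + p + 1 = k + (p + 1) + 1 := by ring
  push_cast
  rw [e, pow_succ]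
  linear_combination (-1) ^ k * ((k : ℂ) + (p + 1) + 1) ^ (-(s + 1)) * hc

lemma altDiff_zero_left (p : ℕ) (s : ℂ) :
    altDiff 0 p s = (p + 1) * altDiff 0 p (s + 1) := by
  have h : (p : ℂ) + 1 ≠ 0 := by exact_mod_cast Nat.succ_ne_zero p
  simp only [altDiff, zero_add, Finset.sum_range_one, pow_zero, Nat.choose_self, Nat.cast_one,
    one_mul, CharP.cast_eq_zero]
  rw [neg_add, ← sub_eq_add_neg, Complex.cpow_sub _ _ h, Complex.cpow_one]
  field_simp

lemma exists_choose_mul_norm_altDiff_le {δ : ℝ} (hδ : 0 < δ) (hδ1 : δ ≤ 1) (K : ℕ) :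
    ∀ (p : ℕ) (S : Set ℂ), IsCompact S → (∀ s ∈ S, -(K : ℝ) < s.re) →
      ∃ B : ℝ, 0 ≤ B ∧ ∀ s ∈ S, ∀ n : ℕ,
        ((n + p).choose p : ℝ) * ‖altDiff n p s‖ ≤ B * ((n : ℝ) + 1) ^ (-(1 - δ)) := by
  induction K with
  | zero =>
    intro p S hS hre
    have hre' : ∀ s ∈ S, 0 < s.re := by simpa using hre
    have hcont : ContinuousOn (fun s : ℂ => ((p : ℝ) + 1) *
        ((1 / δ) ^ s.re * Real.Gamma s.re / ‖Complex.Gamma s‖)) S := by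
      intro s hs
      have h0 := hre' s hs
      have hne (k : ℕ) : s ≠ -k := by
        rintro rfl
        simp at h0
        linarith [k.cast_nonneg (α := ℝ)]
      refine ContinuousAt.continuousWithinAt ?_
      refine continuousAt_const.mul (ContinuousAt.div (ContinuousAt.mul ?_ ?_) ?_ ?_)
      · exact ContinuousAt.rpow continuousAt_const Complex.continuous_re.continuousAt
          (Or.inl (by positivity))
      · refine ContinuousAt.comp (f := Complex.re) (g := Real.Gamma) ?_
          Complex.continuous_re.continuousAt
        refine (Real.differentiableAt_Gamma fun k hk => ?_).continuousAt
        linarith [k.cast_nonneg (α := ℝ)]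
      · exact (Complex.differentiableAt_Gamma s hne).continuousAt.norm
      · exact norm_ne_zero_iff.2 (Complex.Gamma_ne_zero_of_re_pos h0)
    obtain ⟨B, hB⟩ := hS.exists_bound_of_continuousOn hcont
    refine ⟨max B 0, le_max_right _ _, fun s hs n => ?_⟩
    refine (choose_mul_norm_altDiff_le n p hδ hδ1 (hre' s hs)).trans ?_
    gcongr
    exact (le_abs_self _).trans ((hB s hs).trans (le_max_left _ _))
  | succ K ih =>
    intro p S hS hre
    have hS' : IsCompact ((fun s => s + 1) '' S) := hS.image (by fun_prop)
    have hre' : ∀ s ∈ (fun s => s + 1) '' S, -(K : ℝ) < s.re := by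
      rintro _ ⟨s, hs, rfl⟩
      have := hre s hs
      push_cast at this
      simp only [Complex.add_re, Complex.one_re]
      linarith
    obtain ⟨B₁, hB₁, h₁⟩ := ih p _ hS' hre'
    obtain ⟨B₂, hB₂, h₂⟩ := ih (p + 1) _ hS' hre'
    refine ⟨((p : ℝ) + 1) * (B₁ + 2 * B₂), by positivity, fun s hs n => ?_⟩
    replace h₁ := h₁ _ (mem_image_of_mem _ hs)
    replace h₂ := h₂ _ (mem_image_of_mem _ hs)
    have hp : ‖(p : ℂ) + 1‖ = p + 1 := by
      exact_mod_cast Complex.norm_natCast (p + 1)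
    cases n with
    | zero =>
      rw [altDiff_zero_left, norm_mul, hp]
      calc _ = ((p : ℝ) + 1) * (((0 + p).choose p : ℝ) * ‖altDiff 0 p (s + 1)‖) := by ring
        _ ≤ ((p : ℝ) + 1) * (B₁ * (((0 : ℕ) : ℝ) + 1) ^ (-(1 - δ))) :=
          mul_le_mul_of_nonneg_left (h₁ 0) (by positivity)
        _ ≤ ((p : ℝ) + 1) * ((B₁ + 2 * B₂) * (((0 : ℕ) : ℝ) + 1) ^ (-(1 - δ))) := by
          gcongr; linarith
        _ = _ := by ring
    | succ n =>
      have hn : ‖(n : ℂ) + 1‖ = n + 1 := by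
        exact_mod_cast Complex.norm_natCast (n + 1)
      have hch : ((n + 1 + p).choose p : ℝ) * ((n : ℝ) + 1) =
          ((p : ℝ) + 1) * ((n + (p + 1)).choose (p + 1) : ℝ) := by
        have h := Nat.choose_succ_right_eq (n + 1 + p) p
        rw [Nat.add_sub_cancel, show n + 1 + p = n + (p + 1) by ring] at h
        rw [show n + 1 + p = n + (p + 1) by ring, mul_comm ((p : ℝ) + 1)]
        exact_mod_cast h.symm
      have hpow : ((n : ℝ) + 1) ^ (-(1 - δ)) ≤ 2 * (((n + 1 : ℕ) : ℝ) + 1) ^ (-(1 - δ)) := by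
        have n0 : (0 : ℝ) < n + 1 := by positivity
        push_cast
        rw [Real.rpow_neg n0.le, Real.rpow_neg (by positivity), ← div_eq_mul_inv,
          inv_le_comm₀ (by positivity) (by positivity), inv_div, div_le_iff₀ two_pos]
        calc ((n : ℝ) + 1 + 1) ^ (1 - δ) ≤ (((n : ℝ) + 1) * 2) ^ (1 - δ) :=
              Real.rpow_le_rpow (by positivity) (by linarith) (by linarith)
          _ = ((n : ℝ) + 1) ^ (1 - δ) * 2 ^ (1 - δ) := Real.mul_rpow n0.le zero_le_two
          _ ≤ ((n : ℝ) + 1) ^ (1 - δ) * 2 ^ (1 : ℝ) := by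
            gcongr
            · exact one_le_two
            · linarith
          _ = _ := by rw [Real.rpow_one]
      rw [altDiff_succ_left]
      calc ((n + 1 + p).choose p : ℝ) * ‖_‖
          ≤ ((n + 1 + p).choose p : ℝ) * (‖((p : ℂ) + 1) * altDiff (n + 1) p (s + 1)‖ +
            ‖((n : ℂ) + 1) * altDiff n (p + 1) (s + 1)‖) := by gcongr; exact norm_sub_le _ _
        _ = ((p : ℝ) + 1) * (((n + 1 + p).choose p : ℝ) * ‖altDiff (n + 1) p (s + 1)‖) +
            (((n + 1 + p).choose p : ℝ) * ((n : ℝ) + 1)) * ‖altDiff n (p + 1) (s + 1)‖ := by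
          rw [norm_mul, norm_mul, hp, hn]; ring
        _ = ((p : ℝ) + 1) * (((n + 1 + p).choose p : ℝ) * ‖altDiff (n + 1) p (s + 1)‖ +
            ((n + (p + 1)).choose (p + 1) : ℝ) * ‖altDiff n (p + 1) (s + 1)‖) := by
          rw [hch]; ring
        _ ≤ ((p : ℝ) + 1) * (B₁ * (((n + 1 : ℕ) : ℝ) + 1) ^ (-(1 - δ)) +
            B₂ * (2 * (((n + 1 : ℕ) : ℝ) + 1) ^ (-(1 - δ)))) := by
          have := (h₂ n).trans (mul_le_mul_of_nonneg_left hpow hB₂)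
          have := h₁ (n + 1)
          gcongr
        _ = _ := by ring

/-- The integrand of `serN`: the generalized binomial coefficient `C(x, n)`. -/
noncomputable def realBinom (x : ℝ) (n : ℕ) : ℝ :=
  (∏ i ∈ Finset.range n, (x - (i : ℝ))) / (n.factorial : ℝ)

lemma realBinom_succ (x : ℝ) (n : ℕ) :
    realBinom x (n + 1) = realBinom x n * ((x - n) / (n + 1)) := by
  rw [realBinom, realBinom, Finset.prod_range_succ, Nat.factorial_succ]
  push_cast
  field_simp

lemma continuous_realBinom (n : ℕ) : Continuous fun x => realBinom x n := by
  unfold realBinom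
  fun_prop

lemma exists_abs_realBinom_le {a : ℝ} (ha : -1 < a) (b : ℝ) :
    ∃ C : ℝ, 0 ≤ C ∧ ∀ x ∈ Icc a b, ∀ n : ℕ,
    |realBinom x n| ≤ C * ((n : ℝ) + 1) ^ (-(1 + a)) := by
  obtain ⟨M, hM⟩ := exists_nat_ge b
  choose R hR using fun n : ℕ => isCompact_Icc.exists_bound_of_continuousOn
    (s := Icc a b) (continuous_realBinom n).continuousOn
  set C := ∑ n ∈ Finset.range (M + 1), |R n| * ((n : ℝ) + 1) ^ (1 + a) with hC
  refine ⟨C, by positivity, fun x hx n => ?_⟩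
  have hpos (n : ℕ) : (0 : ℝ) < n + 1 := by positivity
  suffices h : |realBinom x n| * ((n : ℝ) + 1) ^ (1 + a) ≤ C by
    rwa [Real.rpow_neg (hpos n).le, ← div_eq_mul_inv, le_div_iff₀ (by positivity)]
  have hsmall (n : ℕ) (hn : n ≤ M) : |realBinom x n| * ((n : ℝ) + 1) ^ (1 + a) ≤ C := by
    calc _ ≤ |R n| * ((n : ℝ) + 1) ^ (1 + a) := by
          refine mul_le_mul_of_nonneg_right ?_ (by positivity)
          exact (hR n x hx).trans (le_abs_self _)
      _ ≤ C := Finset.single_le_sum (f := fun n : ℕ => |R n| * ((n : ℝ) + 1) ^ (1 + a))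
          (fun k _ => by positivity) (by simp; omega)
  rcases le_total n M with hn | hn
  · exact hsmall n hn
  · induction n, hn using Nat.le_induction with
    | base => exact hsmall M le_rfl
    | succ n hn ih =>
      refine le_trans ?_ ih
      have hMn : (M : ℝ) ≤ n := by exact_mod_cast hn
      have habs : |(x - n) / ((n : ℝ) + 1)| ≤ Real.exp (-((1 + a) / (n + 1))) := by
        have e : |(x - n) / ((n : ℝ) + 1)| = (n - x) / (n + 1) := by
          rw [abs_div, abs_of_pos (hpos n), abs_sub_comm, abs_of_nonneg (by linarith [hx.2])]
        calc |(x - n) / ((n : ℝ) + 1)| = (n - x) / (n + 1) := e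
          _ ≤ (n - a) / (n + 1) := by gcongr; exact hx.1
          _ = -((1 + a) / (n + 1)) + 1 := by field_simp; ring
          _ ≤ _ := Real.add_one_le_exp _
      have hlog : Real.log (((n : ℝ) + 1 + 1) / (n + 1)) ≤ 1 / (n + 1) := by
        refine (Real.log_le_sub_one_of_pos (by positivity)).trans (le_of_eq ?_)
        field_simp
        ring
      have hexp : ((n : ℝ) + 1 + 1) ^ (1 + a) ≤
          ((n : ℝ) + 1) ^ (1 + a) * Real.exp ((1 + a) / (n + 1)) := by
        calc ((n : ℝ) + 1 + 1) ^ (1 + a)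
            = (((n : ℝ) + 1) * (((n : ℝ) + 1 + 1) / (n + 1))) ^ (1 + a) := by
              congr 1; field_simp
          _ = ((n : ℝ) + 1) ^ (1 + a) *
              Real.exp (Real.log (((n : ℝ) + 1 + 1) / (n + 1)) * (1 + a)) := by
            rw [Real.mul_rpow (hpos n).le (by positivity),
              Real.rpow_def_of_pos (show 0 < ((n : ℝ) + 1 + 1) / (n + 1) by positivity)]
          _ ≤ ((n : ℝ) + 1) ^ (1 + a) * Real.exp (1 / (n + 1) * (1 + a)) := by
            gcongr
            linarith
          _ = _ := by congr 2; ring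
      rw [realBinom_succ, abs_mul]
      push_cast
      calc _ ≤ |realBinom x n| * Real.exp (-((1 + a) / (n + 1))) *
            (((n : ℝ) + 1) ^ (1 + a) * Real.exp ((1 + a) / (n + 1))) := by gcongr
        _ = |realBinom x n| * ((n : ℝ) + 1) ^ (1 + a) *
            (Real.exp (-((1 + a) / (n + 1))) * Real.exp ((1 + a) / (n + 1))) := by ring
        _ = _ := by rw [← Real.exp_add, neg_add_cancel, Real.exp_zero, mul_one]

lemma serN_eq_integral_realBinom (n m : ℕ) (a : ℝ) :
    serN n m a = ∫ x in a..(a + (m : ℝ)), realBinom x n := rfl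

lemma exists_abs_serN_le (m : ℕ) {a : ℝ} (ha : -1 < a) : ∃ C : ℝ, 0 ≤ C ∧ ∀ n : ℕ,
    |serN n m a| ≤ C * ((n : ℝ) + 1) ^ (-(1 + a)) := by
  obtain ⟨C, hC, h⟩ := exists_abs_realBinom_le ha (a + m)
  have hm : a ≤ a + m := by simp
  refine ⟨C * m, by positivity, fun n => ?_⟩
  have := intervalIntegral.norm_integral_le_of_norm_le_const (a := a) (b := a + m)
    (f := fun x => realBinom x n) (C := C * ((n : ℝ) + 1) ^ (-(1 + a))) (fun x hx => by
      rw [uIoc_of_le hm] at hx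
      exact h x ⟨hx.1.le, hx.2⟩ n)
  rw [serN_eq_integral_realBinom]
  refine this.trans (le_of_eq ?_)
  rw [add_sub_cancel_left, Nat.abs_cast]
  ring

/-- A summable majorant for the series `∑ serN (n + 1) m a * altDiff n 0 s`. -/
lemma exists_serN_weight (m : ℕ) {a : ℝ} (ha : -1 < a) : ∃ δ : ℝ, 0 < δ ∧ δ ≤ 1 ∧
    Summable fun n : ℕ => |serN (n + 1) m a| * ((n : ℝ) + 1) ^ (-(1 - δ)) := by
  obtain ⟨C, hC, h⟩ := exists_abs_serN_le m ha
  have hmin : 0 < min (1 + a) 1 := lt_min (by linarith) one_pos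
  refine ⟨min (1 + a) 1 / 2, by positivity, by linarith [min_le_right (1 + a) 1], ?_⟩
  set δ := min (1 + a) 1 / 2 with hδ
  have hδa : δ < 1 + a := by linarith [min_le_left (1 + a) 1]
  have hs : Summable fun n : ℕ => ((n + 1 : ℕ) : ℝ) ^ (-(1 + a) + -(1 - δ)) :=
    (summable_nat_add_iff 1).2 (Real.summable_nat_rpow.2 (by linarith))
  refine Summable.of_nonneg_of_le (fun n => by positivity) (fun n => ?_) (hs.mul_left C)
  have n0 : (0 : ℝ) < n + 1 := by positivity
  push_cast
  rw [Real.rpow_add n0, ← mul_assoc]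
  gcongr
  refine (h (n + 1)).trans ?_
  refine mul_le_mul_of_nonneg_left ?_ hC
  push_cast
  exact Real.rpow_le_rpow_of_nonpos n0 (by linarith) (by linarith)

/-- The terms of the Ser-type series. -/
noncomputable def serTerm (m : ℕ) (a : ℝ) (n : ℕ) (s : ℂ) : ℂ :=
  (-1) ^ n * (serN (n + 1) m a : ℂ) * altDiff n 0 s

lemma differentiable_altDiff (n p : ℕ) : Differentiable ℂ (altDiff n p) := by
  unfold altDiff
  refine Differentiable.fun_sum fun k _ => Differentiable.const_mul ?_ _
  have h : (k : ℂ) + p + 1 ≠ 0 := by exact_mod_cast Nat.succ_ne_zero (k + p)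
  exact fun s => differentiableAt_id.neg.const_cpow (Or.inl h)

lemma exists_summable_norm_serTerm_le (m : ℕ) {a : ℝ} (ha : -1 < a) {S : Set ℂ}
    (hS : IsCompact S) : ∃ u : ℕ → ℝ, Summable u ∧ ∀ n, ∀ s ∈ S, ‖serTerm m a n s‖ ≤ u n := by
  obtain ⟨δ, hδ, hδ1, hsum⟩ := exists_serN_weight m ha
  obtain ⟨r, hr⟩ := hS.exists_bound_of_continuousOn continuousOn_id
  obtain ⟨K, hK⟩ := exists_nat_gt r
  obtain ⟨B, hB, h⟩ := exists_choose_mul_norm_altDiff_le hδ hδ1 K 0 S hS fun s hs => by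
    have h1 := (abs_le.1 ((Complex.abs_re_le_norm s).trans (hr s hs))).1
    linarith
  refine ⟨_, hsum.mul_left B, fun n s hs => ?_⟩
  have := h s hs n
  rw [Nat.choose_zero_right, Nat.cast_one, one_mul] at this
  rw [serTerm, norm_mul, norm_mul, norm_pow, norm_neg, norm_one, one_pow, one_mul,
    Complex.norm_real, Real.norm_eq_abs]
  calc _ ≤ |serN (n + 1) m a| * (B * ((n : ℝ) + 1) ^ (-(1 - δ))) := by gcongr
    _ = _ := by ring

lemma summable_serTerm (m : ℕ) {a : ℝ} (ha : -1 < a) (s : ℂ) :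
    Summable fun n => serTerm m a n s := by
  obtain ⟨u, hu, h⟩ := exists_summable_norm_serTerm_le m ha (isCompact_singleton (x := s))
  exact Summable.of_norm_bounded hu fun n => h n s rfl

lemma differentiable_tsum_serTerm (m : ℕ) {a : ℝ} (ha : -1 < a) :
    Differentiable ℂ fun s => ∑' n, serTerm m a n s := by
  intro s
  obtain ⟨u, hu, h⟩ := exists_summable_norm_serTerm_le m ha (isCompact_closedBall s 1)
  refine (Complex.differentiableOn_tsum_of_summable_norm hu (fun n => ?_) Metric.isOpen_ball
    fun n w hw => h n w (Metric.ball_subset_closedBall hw)).differentiableAt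
      (Metric.ball_mem_nhds s one_pos)
  exact ((differentiable_altDiff n 0).const_mul _).differentiableOn

lemma descPochhammer_eval_eq_prod_range_sub (x : ℝ) (n : ℕ) :
    (descPochhammer ℤ n).smeval x = ∏ i ∈ Finset.range n, (x - (i : ℝ)) := by
  rw [← Polynomial.eval₂_smulOneHom_eq_smeval]
  induction n with
  | zero => simp
  | succ n ih =>
    rw [Finset.prod_range_succ, descPochhammer_succ_right, Polynomial.eval₂_mul, ih]
    simp

lemma ringChoose_eq_realBinom (x : ℝ) (n : ℕ) : Ring.choose x n = realBinom x n := by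
  have h := Ring.descPochhammer_eq_factorial_smul_choose x n
  rw [descPochhammer_eval_eq_prod_range_sub, nsmul_eq_mul] at h
  rw [realBinom, h, mul_div_cancel_left₀ _ (by positivity)]

lemma hasSum_realBinom_mul_pow (x : ℝ) {z : ℝ} (hz : |z| < 1) :
    HasSum (fun n => realBinom x n * z ^ n) ((1 + z) ^ x) := by
  have h := (Real.one_add_rpow_hasFPowerSeriesOnBall_zero (a := x)).hasSum (y := z) (by
    simpa [enorm_eq_nnnorm, ← NNReal.coe_lt_one] using hz)
  simpa [binomialSeries_apply, ringChoose_eq_realBinom,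
    -FormalMultilinearSeries.apply_eq_prod_smul_coeff] using h

lemma integral_exp_neg_mul (m : ℕ) (a : ℝ) {t : ℝ} (ht : t ≠ 0) :
    ∫ x in a..(a + (m : ℝ)), Real.exp (-(t * x)) =
      (1 - Real.exp (-t)) * ∑ j ∈ Finset.range m, Real.exp (-((a + j) * t)) / t := by
  have hd (x : ℝ) : HasDerivAt (fun x => -Real.exp (-(t * x)) / t) (Real.exp (-(t * x))) x := by
    have := ((((hasDerivAt_id x).const_mul t).neg.exp).neg).div_const t
    convert! this using 1
    field_simp
    simp
  rw [intervalIntegral.integral_eq_sub_of_hasDerivAt (fun x _ => hd x)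
    (Continuous.intervalIntegrable (by fun_prop) _ _)]
  have hg := mul_neg_geom_sum (Real.exp (-t)) m
  have e (j : ℕ) : Real.exp (-((a + j) * t)) / t = Real.exp (-(t * a)) / t * Real.exp (-t) ^ j := by
    rw [← Real.exp_nat_mul, div_mul_eq_mul_div, ← Real.exp_add]
    congr 2
    ring
  have e' : Real.exp (-(t * (a + m))) = Real.exp (-(t * a)) * Real.exp (-t) ^ m := by
    rw [← Real.exp_nat_mul, ← Real.exp_add]
    congr 1
    ring
  simp_rw [e]
  rw [← Finset.mul_sum, e', mul_left_comm, hg]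
  field_simp
  ring

lemma hasSum_serN_mul_pow (m : ℕ) {a : ℝ} (ha : -1 < a) {t : ℝ} (ht : 0 < t) :
    HasSum (fun n => (-1) ^ n * serN (n + 1) m a * (1 - Real.exp (-t)) ^ n)
      (m / (1 - Real.exp (-t)) - ∑ j ∈ Finset.range m, Real.exp (-((a + j) * t)) / t) := by
  set z := 1 - Real.exp (-t) with hz
  have hz1 : z < 1 := by linarith [Real.exp_pos (-t)]
  have hz0 : 0 < z := by
    have : Real.exp (-t) < 1 := by simpa using ht
    linarith
  obtain ⟨C, hC, hbd⟩ := exists_abs_realBinom_le ha (a + m)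
  have hm : a ≤ a + m := by simp
  have h : HasSum (fun n => ∫ x in a..(a + (m : ℝ)), realBinom x n * (-z) ^ n)
      (∫ x in a..(a + (m : ℝ)), Real.exp (-(t * x))) := by
    refine intervalIntegral.hasSum_integral_of_dominated_convergence
      (fun n _ => C * z ^ n) (fun n => ?_) (fun n => ?_) ?_ ?_ ?_
    · exact ((continuous_realBinom n).mul continuous_const).aestronglyMeasurable
    · refine Eventually.of_forall fun x hx => ?_
      rw [uIoc_of_le hm] at hx
      rw [norm_mul, norm_pow, norm_neg, Real.norm_of_nonneg hz0.le, Real.norm_eq_abs]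
      gcongr
      refine (hbd x ⟨hx.1.le, hx.2⟩ n).trans (mul_le_of_le_one_right hC ?_)
      exact Real.rpow_le_one_of_one_le_of_nonpos (by simp) (by linarith)
    · exact Eventually.of_forall fun x _ => (summable_geometric_of_lt_one hz0.le hz1).mul_left C
    · simp
    · refine Eventually.of_forall fun x _ => ?_
      have h := hasSum_realBinom_mul_pow x (z := -z) (by rwa [abs_neg, abs_of_pos hz0])
      convert! h using 1
      rw [hz, neg_sub, add_sub_cancel, ← Real.exp_mul]
      congr 1
      ring
  simp_rw [intervalIntegral.integral_mul_const, ← serN_eq_integral_realBinom] at h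
  have h' := ((hasSum_nat_add_iff' 1).2 h).mul_left (-1 / z)
  convert! h' using 1
  · ext n
    rw [neg_pow z, pow_succ (-1 : ℝ), pow_succ z]
    field_simp
  · have h0 : serN 0 m a = m := by simp [serN]
    rw [integral_exp_neg_mul m a ht.ne', Finset.sum_range_one, h0, ← hz]
    generalize ∑ j ∈ Finset.range m, Real.exp (-((a + j) * t)) / t = S
    field_simp
    ring

lemma integrableOn_and_integral_exp_term {r : ℝ} (hr : 0 < r) {s : ℂ} (hs : 1 < s.re) :
    IntegrableOn (fun t : ℝ => (t : ℂ) ^ (s - 1) * ((Real.exp (-(r * t)) / t : ℝ) : ℂ)) (Ioi 0) ∧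
      ∫ t in Ioi (0 : ℝ), (t : ℂ) ^ (s - 1) * ((Real.exp (-(r * t)) / t : ℝ) : ℂ) =
        (r : ℂ) ^ (1 - s) * Complex.Gamma (s - 1) := by
  have hs' : 0 < (s - 1).re := by simpa using hs
  have hI := Complex.integral_cpow_mul_exp_neg_mul_Ioi hs' hr
  have hr0 : (r : ℂ) ≠ 0 := by exact_mod_cast hr.ne'
  have hI' : ∫ t in Ioi (0 : ℝ), (t : ℂ) ^ (s - 1) * ((Real.exp (-(r * t)) / t : ℝ) : ℂ) =
      (r : ℂ) ^ (1 - s) * Complex.Gamma (s - 1) := by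
    rw [one_div, Complex.inv_cpow _ _ (by
      rw [Complex.arg_ofReal_of_nonneg hr.le]; exact Real.pi_ne_zero.symm), ← Complex.cpow_neg,
      neg_sub] at hI
    rw [← hI]
    refine setIntegral_congr_fun measurableSet_Ioi fun t ht => ?_
    have ht0 : (t : ℂ) ≠ 0 := by exact_mod_cast (ne_of_gt ht : t ≠ 0)
    rw [Complex.cpow_sub (s - 1) 1 ht0, Complex.cpow_one]
    push_cast
    ring
  refine ⟨not_imp_comm.1 integral_undef ?_, hI'⟩
  rw [hI']
  refine mul_ne_zero ?_ (Complex.Gamma_ne_zero_of_re_pos hs')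
  simp [Complex.cpow_eq_zero_iff, hr0]

lemma integrableOn_and_integral_zeta_kernel {s : ℂ} (hs : 1 < s.re) :
    IntegrableOn (fun t : ℝ => (t : ℂ) ^ (s - 1) *
        ((Real.exp (-t) / (1 - Real.exp (-t)) : ℝ) : ℂ)) (Ioi 0) ∧
      ∫ t in Ioi (0 : ℝ), (t : ℂ) ^ (s - 1) * ((Real.exp (-t) / (1 - Real.exp (-t)) : ℝ) : ℂ) =
        Complex.Gamma s * riemannZeta s := by
  have hs0 : 0 < s.re := by linarith
  have h := hasSum_mellin (ι := ℕ) (a := fun _ => 1) (p := fun k => (k : ℝ) + 1)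
    (F := fun t => ((Real.exp (-t) / (1 - Real.exp (-t)) : ℝ) : ℂ)) (s := s)
    (fun k => Or.inr (by positivity)) hs0 (fun t ht => ?_) ?_
  · have hI : ∫ t in Ioi (0 : ℝ), (t : ℂ) ^ (s - 1) *
        ((Real.exp (-t) / (1 - Real.exp (-t)) : ℝ) : ℂ) = Complex.Gamma s * riemannZeta s := by
      rw [zeta_eq_tsum_one_div_nat_add_one_cpow hs, ← tsum_mul_left]
      refine h.tsum_eq.symm.trans (tsum_congr fun k => ?_)
      push_cast
      ring
    refine ⟨not_imp_comm.1 integral_undef ?_, hI⟩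
    rw [hI]
    exact mul_ne_zero (Complex.Gamma_ne_zero_of_re_pos hs0)
      (riemannZeta_ne_zero_of_one_lt_re hs)
  · have h1 : Real.exp (-t) < 1 := by simpa using ht
    have hg := (hasSum_geometric_of_lt_one (Real.exp_pos (-t)).le h1).mul_left (Real.exp (-t))
    rw [← div_eq_mul_inv] at hg
    have hg' := Complex.hasSum_ofReal.2 hg
    refine hg'.congr_fun fun k => ?_
    rw [one_mul, ← pow_succ', ← Real.exp_nat_mul]
    congr 2
    push_cast
    ring
  · have := (summable_nat_add_iff 1).2 (Real.summable_one_div_nat_rpow.2 hs)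
    simpa using this

lemma Gamma_mul_tsum_serTerm (m : ℕ) {a : ℝ} (ha : -1 < a) {s : ℂ} (hs : 1 < s.re) :
    Complex.Gamma s * ∑' n, serTerm m a n s = m * (Complex.Gamma s * riemannZeta s) -
      ∑ j ∈ Finset.range m, ((a + j + 1 : ℝ) : ℂ) ^ (1 - s) * Complex.Gamma (s - 1) := by
  have hs0 : 0 < s.re := by linarith
  set c : ℕ → ℝ := fun n => (-1) ^ n * serN (n + 1) m a with hc
  set F : ℕ → ℝ → ℂ := fun n t => (c n : ℂ) * ((t : ℂ) ^ (s - 1) * (expKernel n 0 t : ℂ)) with hF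
  have hFint (n : ℕ) : IntegrableOn (F n) (Ioi 0) :=
    (integrableOn_cpow_mul_expKernel n 0 hs0).const_mul _
  have hFsum : Summable fun n => ∫ t in Ioi (0 : ℝ), ‖F n t‖ := by
    obtain ⟨δ, hδ, hδ1, hsum⟩ := exists_serN_weight m ha
    refine Summable.of_nonneg_of_le (fun n => integral_nonneg fun t => norm_nonneg _)
      (fun n => ?_) (hsum.mul_right ((1 / δ) ^ s.re * Real.Gamma s.re))
    have h := integral_norm_cpow_mul_expKernel_le n 0 hδ hδ1 hs0
    simp only [Nat.choose_zero_right, Nat.cast_one, one_mul, CharP.cast_eq_zero, zero_add] at h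
    have hcn : ‖(c n : ℂ)‖ = |serN (n + 1) m a| := by
      simp [hc]
    simp only [hF, norm_mul (c n : ℂ), hcn, MeasureTheory.integral_const_mul]
    rw [mul_assoc]
    exact mul_le_mul_of_nonneg_left h (abs_nonneg _)
  have h := hasSum_integral_of_summable_integral_norm hFint hFsum
  have hterm (n : ℕ) : ∫ t in Ioi (0 : ℝ), F n t = Complex.Gamma s * serTerm m a n s := by
    have := mellin_expKernel n 0 hs0
    simp only [mellin, smul_eq_mul] at this
    simp only [hF, MeasureTheory.integral_const_mul, this, hc, serTerm]
    push_cast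
    ring
  simp_rw [hterm] at h
  rw [← tsum_mul_left, h.tsum_eq]
  have hr (j : ℕ) : 0 < a + j + 1 := by linarith [j.cast_nonneg (α := ℝ)]
  obtain ⟨hZ, hZ'⟩ := integrableOn_and_integral_zeta_kernel hs
  have hE (j : ℕ) := integrableOn_and_integral_exp_term (hr j) hs
  rw [← hZ', ← MeasureTheory.integral_const_mul, ← Finset.sum_congr rfl fun j _ => (hE j).2,
    ← integral_finsetSum _ fun j _ => (hE j).1, ← MeasureTheory.integral_sub (hZ.const_mul _)
      (integrable_finsetSum _ fun j _ => (hE j).1)]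
  refine setIntegral_congr_fun measurableSet_Ioi fun t ht => ?_
  have hsum := Complex.hasSum_ofReal.2 ((hasSum_serN_mul_pow m ha ht).mul_left (Real.exp (-t)))
  have hsum' := (hsum.mul_left ((t : ℂ) ^ (s - 1))).tsum_eq
  have hFt (n : ℕ) : F n t = (t : ℂ) ^ (s - 1) * ((Real.exp (-t) *
      ((-1) ^ n * serN (n + 1) m a * (1 - Real.exp (-t)) ^ n) : ℝ) : ℂ) := by
    simp only [hF, hc, expKernel]
    push_cast
    ring
  have hexp (j : ℕ) : Real.exp (-((a + j + 1) * t)) / t =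
      Real.exp (-t) * (Real.exp (-((a + j) * t)) / t) := by
    rw [mul_div_assoc', ← Real.exp_add]
    congr 2
    ring
  simp only [hFt, hsum', hexp]
  push_cast
  rw [← Finset.mul_sum, ← Finset.mul_sum]
  ring

lemma riemannZeta_eq_of_one_lt_re {m : ℕ} (hm : 1 ≤ m) {a : ℝ} (ha : -1 < a) {s : ℂ}
    (hs : 1 < s.re) : riemannZeta s = (1 / ((m : ℂ) * (s - 1))) *
      ∑ n ∈ Finset.range m, ((a : ℂ) + (n : ℂ) + 1) ^ (1 - s) +
        (1 / (m : ℂ)) * ∑' n, serTerm m a n s := by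
  have hs1 : s - 1 ≠ 0 := by
    intro h
    have := congrArg Complex.re h
    simp at this
    linarith
  have hm0 : (m : ℂ) ≠ 0 := by exact_mod_cast (by omega : m ≠ 0)
  have hΓ : Complex.Gamma (s - 1) ≠ 0 := Complex.Gamma_ne_zero_of_re_pos (by simpa using hs)
  have h := Gamma_mul_tsum_serTerm m ha hs
  have hΓs : Complex.Gamma s = (s - 1) * Complex.Gamma (s - 1) := by
    rw [← Complex.Gamma_add_one _ hs1, sub_add_cancel]
  rw [hΓs, ← Finset.sum_mul] at h
  push_cast at h
  field_simp
  refine mul_right_cancel₀ hΓ ?_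
  linear_combination -h

lemma riemannZeta_eq_serTerm {m : ℕ} (hm : 1 ≤ m) {a : ℝ} (ha : -1 < a) {s : ℂ}
    (hs : s ≠ 1) : riemannZeta s = (1 / ((m : ℂ) * (s - 1))) *
      ∑ n ∈ Finset.range m, ((a : ℂ) + (n : ℂ) + 1) ^ (1 - s) +
        (1 / (m : ℂ)) * ∑' n, serTerm m a n s := by
  have hm0 : (m : ℂ) ≠ 0 := by exact_mod_cast (by omega : m ≠ 0)
  have hopen : IsOpen ({1}ᶜ : Set ℂ) := isOpen_compl_singleton
  have hL : AnalyticOnNhd ℂ riemannZeta {1}ᶜ :=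
    DifferentiableOn.analyticOnNhd
      (fun z hz => (differentiableAt_riemannZeta hz).differentiableWithinAt) hopen
  have hR : AnalyticOnNhd ℂ (fun s : ℂ => (1 / ((m : ℂ) * (s - 1))) *
      ∑ n ∈ Finset.range m, ((a : ℂ) + (n : ℂ) + 1) ^ (1 - s) +
        (1 / (m : ℂ)) * ∑' n, serTerm m a n s) {1}ᶜ := by
    refine DifferentiableOn.analyticOnNhd (fun z hz => ?_) hopen
    refine DifferentiableAt.differentiableWithinAt ?_
    refine .add (.mul ?_ ?_) (((differentiable_tsum_serTerm m ha) z).const_mul _)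
    · refine (differentiableAt_const _).div ?_ (mul_ne_zero hm0 (sub_ne_zero.2 hz))
      exact (differentiableAt_id.sub_const _).const_mul _
    · refine DifferentiableAt.fun_sum fun n _ => ?_
      have h : (a : ℂ) + n + 1 ≠ 0 := by
        have : a + n + 1 ≠ 0 := by linarith [n.cast_nonneg (α := ℝ)]
        exact_mod_cast this
      exact (differentiableAt_id.const_sub _).const_cpow (Or.inl h)
  have h2 : (2 : ℂ) ∈ ({1}ᶜ : Set ℂ) := by simp
  have hev : riemannZeta =ᶠ[𝓝 2] fun s : ℂ => (1 / ((m : ℂ) * (s - 1))) *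
      ∑ n ∈ Finset.range m, ((a : ℂ) + (n : ℂ) + 1) ^ (1 - s) +
        (1 / (m : ℂ)) * ∑' n, serTerm m a n s := by
    filter_upwards [(isOpen_lt continuous_const Complex.continuous_re).mem_nhds
      (show (1 : ℝ) < (2 : ℂ).re by simp)] with z hz
    exact riemannZeta_eq_of_one_lt_re hm ha hz
  exact hL.eqOn_of_preconnected_of_eventuallyEq hR
    (isConnected_compl_singleton_of_one_lt_rank (by simp) 1).isPreconnected h2 hev hs

/-- Generalized Ser-type series for the Riemann zeta function: for integers `m ≥ 1`,
real `a > −1` and complex `s ≠ 1`,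
`ζ(s) = (1/(m(s−1))) Σ_{n=1}^{m} (a+n)^{1−s}
  + (1/m) Σ_{n=0}^∞ (−1)^n N_{n+1,m}(a) Σ_{k=0}^n (−1)^k C(n,k) (k+1)^{−s}`,
the outer infinite series being convergent. -/
theorem zeta_serN_series (m : ℕ) (hm : 1 ≤ m) (a : ℝ) (ha : -1 < a)
    (s : ℂ) (hs : s ≠ 1) :
    ∃ L : ℂ,
      Tendsto (fun N : ℕ => ∑ n ∈ Finset.range N,
          (-1) ^ n * (Complex.ofReal (serN (n + 1) m a)) *
          ∑ k ∈ Finset.range (n + 1), (-1) ^ k * (n.choose k : ℂ) * ((k : ℂ) + 1) ^ (-s))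
        atTop (nhds L) ∧
      riemannZeta s =
        (1 / ((m : ℂ) * (s - 1))) * ∑ n ∈ Finset.range m, ((a : ℂ) + (n : ℂ) + 1) ^ (1 - s)
          + (1 / (m : ℂ)) * L := by
  refine ⟨∑' n, serTerm m a n s, ?_, riemannZeta_eq_serTerm hm ha hs⟩
  simpa [serTerm, altDiff] using (summable_serTerm m ha s).hasSum.tendsto_sum_nat
end

section
/- Let k ≥ 2 be an integer and let s be a complex number with Re s > 1 and s ∉ {2, 3, …, k}. Then ζ(s) = −Σ_{l=1}^{k−1} [(k−l+1)(k−l+2)···k] / [(s−l)(s−l+1)···(s−1)] · ζ(s−l) + k/(s−k) + k Σ_{n=0}^∞ (−1)^n G_{n+1}^{(k)} Σ_{j=0}^n (−1)^j C(n,j) (j+1)^{−s}, the outer series being convergent, where G_n^{(k)} are Gregory's coefficients of higher order. -/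
open Filter Finset intervalIntegral

/-- Gregory's coefficients of higher order
`G_n^{(k)} = ∫₀¹ x^{k−1} · x(x−1)(x−2)⋯(x−n+1)/n! dx`. -/
noncomputable def gregoryGk (n k : ℕ) : ℝ :=
  ∫ x in (0:ℝ)..1, x ^ (k - 1) * (∏ i ∈ Finset.range n, (x - (i : ℝ))) / (n.factorial : ℝ)

open Set Topology MeasureTheory

/-- The Bose–Einstein kernel `1 / (e^t - 1)`. -/
noncomputable def boseKernel (t : ℝ) : ℝ := (Real.exp t - 1)⁻¹

/-- The truncated exponential moment `∫₀¹ x^k e^{-xt} dx`. -/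
noncomputable def expMoment (k : ℕ) (t : ℝ) : ℝ := ∫ x in (0:ℝ)..1, x ^ k * Real.exp (-(x * t))

lemma exp_sub_one_pos {t : ℝ} (ht : 0 < t) : 0 < Real.exp t - 1 := by
  linarith [Real.add_one_lt_exp ht.ne']

lemma boseKernel_pos {t : ℝ} (ht : 0 < t) : 0 < boseKernel t :=
  inv_pos.2 (exp_sub_one_pos ht)

lemma boseKernel_eq_exp_div {t : ℝ} (ht : 0 < t) :
    boseKernel t = Real.exp (-t) / (1 - Real.exp (-t)) := by
  have h := exp_sub_one_pos ht
  have h2 : 1 - Real.exp (-t) ≠ 0 := by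
    have : Real.exp (-t) < 1 := Real.exp_lt_one_iff.2 (by linarith)
    linarith
  rw [boseKernel, Real.exp_neg] at *
  have := Real.exp_pos t
  field_simp

lemma continuousOn_boseKernel : ContinuousOn boseKernel (Ioi 0) := by
  unfold boseKernel
  exact ContinuousOn.inv₀ (by fun_prop) fun t ht => (exp_sub_one_pos ht).ne'

lemma boseKernel_le_rpow {t : ℝ} (ht : 0 < t) : boseKernel t ≤ t ^ (-1 : ℝ) := by
  rw [Real.rpow_neg_one, boseKernel]
  exact inv_anti₀ ht (by linarith [Real.add_one_le_exp t])

lemma boseKernel_le_exp {t : ℝ} (ht : 1 ≤ t) : boseKernel t ≤ 2 * Real.exp (-t) := by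
  rw [boseKernel, Real.exp_neg, inv_le_comm₀ (exp_sub_one_pos (by linarith)) (by positivity),
    mul_inv, inv_inv]
  linarith [Real.add_one_le_exp t]

section DominatedByBose

variable {f : ℝ → ℝ} {C : ℝ} {s : ℂ}

lemma isBigO_atTop_of_le_boseKernel (hle : ∀ t, 0 < t → |f t| ≤ C * boseKernel t) :
    (fun t => (f t : ℂ)) =O[atTop] fun t => Real.exp (-1 * t) := by
  refine Asymptotics.IsBigO.of_bound (|C| * 2) ?_
  filter_upwards [eventually_ge_atTop 1] with t ht
  rw [Complex.norm_real, Real.norm_eq_abs, Real.norm_eq_abs, Real.abs_exp, neg_one_mul, mul_assoc]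
  refine (hle t (by linarith)).trans ?_
  have := boseKernel_pos (by linarith : 0 < t)
  exact (mul_le_mul_of_nonneg_right (le_abs_self C) this.le).trans
    (mul_le_mul_of_nonneg_left (boseKernel_le_exp ht) (abs_nonneg C))

lemma isBigO_zero_of_le_boseKernel (hle : ∀ t, 0 < t → |f t| ≤ C * boseKernel t) :
    (fun t => (f t : ℂ)) =O[𝓝[>] 0] fun t => t ^ (-1 : ℝ) := by
  refine Asymptotics.IsBigO.of_bound |C| ?_
  filter_upwards [self_mem_nhdsWithin] with t ht
  rw [Complex.norm_real, Real.norm_eq_abs, Real.norm_eq_abs]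
  refine (hle t ht).trans ?_
  have := boseKernel_pos (show 0 < t from ht)
  exact (mul_le_mul_of_nonneg_right (le_abs_self C) this.le).trans
    (mul_le_mul_of_nonneg_left ((boseKernel_le_rpow ht).trans (le_abs_self _)) (abs_nonneg C))

lemma locallyIntegrableOn_ofReal (hf : ContinuousOn f (Ioi 0)) :
    LocallyIntegrableOn (fun t => (f t : ℂ)) (Ioi 0) :=
  (Complex.continuous_ofReal.comp_continuousOn hf).locallyIntegrableOn measurableSet_Ioi

lemma mellinConvergent_of_le_boseKernel (hf : ContinuousOn f (Ioi 0))
    (hle : ∀ t, 0 < t → |f t| ≤ C * boseKernel t) (hs : 1 < s.re) :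
    MellinConvergent (fun t => (f t : ℂ)) s :=
  mellinConvergent_of_isBigO_rpow_exp one_pos (locallyIntegrableOn_ofReal hf)
    (isBigO_atTop_of_le_boseKernel hle) (isBigO_zero_of_le_boseKernel hle) hs

lemma differentiableAt_mellin_of_le_boseKernel (hf : ContinuousOn f (Ioi 0))
    (hle : ∀ t, 0 < t → |f t| ≤ C * boseKernel t) (hs : 1 < s.re) :
    DifferentiableAt ℂ (mellin fun t => (f t : ℂ)) s :=
  mellin_differentiableAt_of_isBigO_rpow_exp one_pos (locallyIntegrableOn_ofReal hf)
    (isBigO_atTop_of_le_boseKernel hle) (isBigO_zero_of_le_boseKernel hle) hs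

end DominatedByBose

lemma continuous_expMoment (k : ℕ) : Continuous (expMoment k) := by
  unfold expMoment
  exact intervalIntegral.continuous_parametric_intervalIntegral_of_continuous' (by fun_prop) _ _

lemma expMoment_nonneg (k : ℕ) (t : ℝ) : 0 ≤ expMoment k t := by
  refine intervalIntegral.integral_nonneg zero_le_one fun x hx => ?_
  have := hx.1
  positivity

lemma expMoment_le (k : ℕ) {t : ℝ} (ht : 0 < t) : expMoment k t ≤ 1 / (k + 1) := by
  have : ∫ x in (0:ℝ)..1, x ^ k = 1 / (k + 1) := by simp
  rw [← this]
  refine intervalIntegral.integral_mono_on zero_le_one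
    (by apply Continuous.intervalIntegrable; fun_prop)
    (by apply Continuous.intervalIntegrable; fun_prop) fun x hx => ?_
  have h0 := hx.1
  exact mul_le_of_le_one_right (by positivity) (Real.exp_le_one_iff.2 (by nlinarith))

lemma expMoment_zero {t : ℝ} (ht : 0 < t) : expMoment 0 t = (1 - Real.exp (-t)) / t := by
  have hd : ∀ x ∈ uIcc (0:ℝ) 1, HasDerivAt (fun x => -Real.exp (-(x * t)) / t)
      (x ^ 0 * Real.exp (-(x * t))) x := fun x _ => by
    have := ((((hasDerivAt_id x).mul_const t).neg.exp).neg.div_const t)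
    convert! this using 1
    simp; field_simp
  rw [expMoment, intervalIntegral.integral_eq_sub_of_hasDerivAt hd
    (by apply Continuous.intervalIntegrable; fun_prop)]
  simp; ring

lemma expMoment_succ (k : ℕ) {t : ℝ} (ht : 0 < t) :
    expMoment (k + 1) t = ((k + 1) * expMoment k t - Real.exp (-t)) / t := by
  have hd : ∀ x ∈ uIcc (0:ℝ) 1, HasDerivAt (fun x => -(x ^ (k + 1) * Real.exp (-(x * t))) / t)
      (x ^ (k + 1) * Real.exp (-(x * t)) - (k + 1) / t * (x ^ k * Real.exp (-(x * t)))) x :=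
    fun x _ => by
      have := ((hasDerivAt_pow (k + 1) x).mul
        ((hasDerivAt_id x).mul_const t).neg.exp).neg.div_const t
      convert! this using 1
      simp; field_simp; ring
  have := intervalIntegral.integral_eq_sub_of_hasDerivAt hd
    (by apply Continuous.intervalIntegrable; fun_prop)
  rw [intervalIntegral.integral_sub (by apply Continuous.intervalIntegrable; fun_prop)
    (by apply Continuous.intervalIntegrable; fun_prop), intervalIntegral.integral_const_mul] at this
  simp only [expMoment]
  rw [sub_eq_iff_eq_add.1 this]
  simp; ring

lemma continuousOn_expMoment_mul_boseKernel (k : ℕ) :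
    ContinuousOn (fun t => expMoment k t * boseKernel t) (Ioi 0) :=
  (continuous_expMoment k).continuousOn.mul continuousOn_boseKernel

lemma abs_expMoment_mul_boseKernel_le (k : ℕ) (t : ℝ) (ht : 0 < t) :
    |expMoment k t * boseKernel t| ≤ 1 / (k + 1) * boseKernel t := by
  have hb := boseKernel_pos ht
  rw [abs_of_nonneg (mul_nonneg (expMoment_nonneg k t) hb.le)]
  exact mul_le_mul_of_nonneg_right (expMoment_le k ht) hb.le

lemma hasSum_boseKernel {t : ℝ} (ht : 0 < t) :
    HasSum (fun n : ℕ => Real.exp (-(n + 1) * t)) (boseKernel t) := by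
  have := (hasSum_geometric_of_lt_one (Real.exp_pos (-t)).le
    (Real.exp_lt_one_iff.2 (by linarith : -t < 0))).mul_left (Real.exp (-t))
  rw [boseKernel_eq_exp_div ht, div_eq_mul_inv]
  convert! this using 2 with n
  rw [← Real.exp_nat_mul, ← Real.exp_add]
  ring_nf

lemma mellin_boseKernel {s : ℂ} (hs : 1 < s.re) :
    mellin (fun t => (boseKernel t : ℂ)) s = Complex.Gamma s * riemannZeta s := by
  have h := hasSum_mellin (a := fun _ : ℕ => 1) (p := fun n => (n:ℝ) + 1)
    (F := fun t => (boseKernel t : ℂ)) (s := s) (fun n => Or.inr (by positivity)) (by linarith)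
    (fun t ht => by
      have := Complex.hasSum_ofReal.2 (hasSum_boseKernel ht)
      simpa using this)
    (by
      have := (summable_nat_add_iff 1).2 (Real.summable_one_div_nat_rpow.2 hs)
      simpa using this)
  rw [← h.tsum_eq, zeta_eq_tsum_one_div_nat_add_one_cpow hs, ← tsum_mul_left]
  congr 1; ext n; simp [div_eq_mul_inv]

lemma mellin_exp_neg {s : ℂ} (hs : 0 < s.re) :
    mellin (fun t => (Real.exp (-t) : ℂ)) s = Complex.Gamma s := by
  rw [Complex.Gamma_eq_integral hs, Complex.GammaIntegral_eq_mellin]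

lemma mellin_exp_neg_mul_boseKernel {s : ℂ} (hs : 1 < s.re) :
    mellin (fun t => ((Real.exp (-t) * boseKernel t : ℝ) : ℂ)) s =
      Complex.Gamma s * (riemannZeta s - 1) := by
  have h1 : ∀ t, 0 < t → |Real.exp (-t)| ≤ 1 * boseKernel t := fun t ht => by
    have := exp_sub_one_pos ht
    rw [Real.abs_exp, one_mul, boseKernel, Real.exp_neg]
    exact inv_anti₀ this (by linarith)
  have h2 : ∀ t, 0 < t → |boseKernel t| ≤ 1 * boseKernel t := fun t ht => by
    rw [abs_of_pos (boseKernel_pos ht), one_mul]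
  have := (hasMellin_sub (mellinConvergent_of_le_boseKernel continuousOn_boseKernel h2 hs)
    (mellinConvergent_of_le_boseKernel (by fun_prop) h1 hs)).2
  rw [mellin_boseKernel hs, mellin_exp_neg (by linarith)] at this
  rw [mul_sub, mul_one, ← this]
  refine setIntegral_congr_fun measurableSet_Ioi fun t ht => ?_
  simp only
  rw [← Complex.ofReal_sub]
  congr 2
  have := exp_sub_one_pos (show 0 < t from ht)
  rw [boseKernel, Real.exp_neg]
  have := Real.exp_pos t
  field_simp
  ring

/-- The combination of shifted zeta values equal to `k ∫₀¹ x^{k-1} ζ(s, 1 + x) dx`. -/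
noncomputable def shiftedZetaSum (k : ℕ) (s : ℂ) : ℂ :=
  -(∑ l ∈ Finset.Icc 1 (k - 1),
      (∏ i ∈ Finset.range l, ((k : ℂ) - (l : ℂ) + 1 + (i : ℂ))) /
        (∏ i ∈ Finset.range l, (s - (l : ℂ) + (i : ℂ))) * riemannZeta (s - (l : ℂ)))
    + (k : ℂ) / (s - (k : ℂ))

lemma shiftedZetaSum_one (s : ℂ) : shiftedZetaSum 1 s = 1 / (s - 1) := by
  simp [shiftedZetaSum]

lemma shiftedZetaSum_succ (k : ℕ) {s : ℂ} (h1 : s ≠ 1) (hk : s ≠ k + 2) :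
    shiftedZetaSum (k + 2) s =
      (k + 2) / (s - 1) * (1 - riemannZeta (s - 1) + shiftedZetaSum (k + 1) (s - 1)) := by
  have h1' := sub_ne_zero.2 h1
  have hk' : s - (k + 2) ≠ 0 := sub_ne_zero.2 hk
  have hk'' : s - 1 - (k + 1) ≠ 0 := by convert! hk' using 1; ring
  have hfrac : (k + 2 : ℂ) / (s - (k + 2)) =
      (k + 2) / (s - 1) * (1 + (k + 1) / (s - 1 - (k + 1))) := by
    field_simp; ring
  simp only [shiftedZetaSum, show k + 2 - 1 = k + 1 from rfl,
    show k + 1 - 1 = k from rfl]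
  have hI (n : ℕ) : Finset.Icc 1 n = Finset.Ico 1 (n + 1) := by ext; simp
  rw [hI, hI, Finset.sum_Ico_eq_sum_range, Finset.sum_Ico_eq_sum_range]
  simp only [Nat.add_sub_cancel]
  rw [Finset.sum_range_succ']
  have hterm : ∀ m : ℕ, (∏ i ∈ Finset.range (1 + (m + 1)),
        (((k + 2 : ℕ) : ℂ) - ((1 + (m + 1) : ℕ) : ℂ) + 1 + (i : ℂ))) /
        (∏ i ∈ Finset.range (1 + (m + 1)), (s - ((1 + (m + 1) : ℕ) : ℂ) + (i : ℂ))) *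
          riemannZeta (s - ((1 + (m + 1) : ℕ) : ℂ)) =
      (k + 2) / (s - 1) * ((∏ i ∈ Finset.range (1 + m),
        (((k + 1 : ℕ) : ℂ) - ((1 + m : ℕ) : ℂ) + 1 + (i : ℂ))) /
        (∏ i ∈ Finset.range (1 + m), (s - 1 - ((1 + m : ℕ) : ℂ) + (i : ℂ))) *
          riemannZeta (s - 1 - ((1 + m : ℕ) : ℂ))) := by
    intro m
    rw [← add_assoc, Finset.prod_range_succ, Finset.prod_range_succ]
    have e1 : ∀ i : ℕ, ((k + 2 : ℕ) : ℂ) - ((1 + m + 1 : ℕ) : ℂ) + 1 + (i : ℂ) =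
      ((k + 1 : ℕ) : ℂ) - ((1 + m : ℕ) : ℂ) + 1 + (i : ℂ) := fun i => by push_cast; ring
    have e3 : s - ((1 + m + 1 : ℕ) : ℂ) = s - 1 - ((1 + m : ℕ) : ℂ) := by push_cast; ring
    simp only [e1, e3]
    have e4 : ((k + 1 : ℕ) : ℂ) - ((1 + m : ℕ) : ℂ) + 1 + ((1 + m : ℕ) : ℂ) = k + 2 := by
      push_cast; ring
    rw [e4, sub_add_cancel]
    rw [mul_div_mul_comm]
    ring
  simp only [hterm, ← Finset.mul_sum]
  push_cast
  rw [hfrac]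
  simp
  ring

lemma mellin_expMoment_mul_boseKernel_of_lt (k : ℕ) {s : ℂ} (hs : k + 1 < s.re) :
    (k + 1) * mellin (fun t => ((expMoment k t * boseKernel t : ℝ) : ℂ)) s =
      Complex.Gamma s * shiftedZetaSum (k + 1) s := by
  have hrec (f g : ℝ → ℝ) (h : ∀ t, 0 < t → f t = g t / t) (s : ℂ) :
      mellin (fun t => (f t : ℂ)) s = mellin (fun t => (g t : ℂ)) (s - 1) := by
    rw [sub_eq_add_neg, ← mellin_cpow_smul]
    refine setIntegral_congr_fun measurableSet_Ioi fun t ht => ?_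
    simp only
    rw [h t ht, Complex.cpow_neg_one, smul_eq_mul, smul_eq_mul, smul_eq_mul]
    push_cast; ring
  induction k generalizing s with
  | zero =>
    have h1 : s - 1 ≠ 0 := fun h => by
      rw [sub_eq_zero.1 h] at hs; simp at hs
    rw [hrec _ (fun t => Real.exp (-t)), mellin_exp_neg (by simpa using hs), zero_add,
      shiftedZetaSum_one]
    · have := Complex.Gamma_add_one (s - 1) h1
      rw [sub_add_cancel] at this
      rw [this]; push_cast; field_simp; ring
    · intro t ht
      rw [expMoment_zero ht, boseKernel_eq_exp_div ht]
      have : Real.exp (-t) < 1 := Real.exp_lt_one_iff.2 (by linarith)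
      have : 1 - Real.exp (-t) ≠ 0 := by linarith
      field_simp
  | succ k ih =>
    push_cast at hs
    have hk0 : (0:ℝ) ≤ k := k.cast_nonneg
    have h1 : s ≠ 1 := fun h => by rw [h] at hs; simp at hs; linarith
    have h2 : s ≠ k + 2 := fun h => by rw [h] at hs; simp at hs; linarith
    have h1' := sub_ne_zero.2 h1
    have hs1 : 1 < (s - 1).re := by simp; linarith
    have hexp : ∀ t, 0 < t → |Real.exp (-t) * boseKernel t| ≤ 1 * boseKernel t := fun t ht => by
      rw [abs_of_pos (mul_pos (Real.exp_pos _) (boseKernel_pos ht))]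
      exact mul_le_mul_of_nonneg_right (Real.exp_le_one_iff.2 (by linarith)) (boseKernel_pos ht).le
    have hM := (hasMellin_sub ((mellinConvergent_of_le_boseKernel
      (continuousOn_expMoment_mul_boseKernel k) (abs_expMoment_mul_boseKernel_le k) hs1).const_smul
        (k + 1 : ℂ)) (mellinConvergent_of_le_boseKernel
      (f := fun t => Real.exp (-t) * boseKernel t)
      ((by fun_prop : Continuous fun t : ℝ => Real.exp (-t)).continuousOn.mul
        continuousOn_boseKernel) hexp hs1)).2
    rw [mellin_const_smul, mellin_exp_neg_mul_boseKernel hs1, smul_eq_mul,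
      ih (s := s - 1) (by simp; linarith)] at hM
    rw [hrec _ (fun t => (k + 1) * (expMoment k t * boseKernel t) -
      Real.exp (-t) * boseKernel t)]
    · have e : (fun t => (((k + 1) * (expMoment k t * boseKernel t) -
          Real.exp (-t) * boseKernel t : ℝ) : ℂ)) = fun t =>
          (k + 1 : ℂ) • ((expMoment k t * boseKernel t : ℝ) : ℂ) -
            ((Real.exp (-t) * boseKernel t : ℝ) : ℂ) := by
        ext t; push_cast; simp
      rw [e, hM, shiftedZetaSum_succ k h1 h2]
      have := Complex.Gamma_add_one (s - 1) h1'
      rw [sub_add_cancel] at this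
      rw [this]; push_cast; field_simp; ring
    · intro t ht
      rw [expMoment_succ k ht]; ring

lemma differentiableAt_shiftedZetaSum (k : ℕ) {s : ℂ} (h : ∀ j : ℕ, 1 ≤ j → j ≤ k → s ≠ j)
    (hk : 1 ≤ k) : DifferentiableAt ℂ (shiftedZetaSum k) s := by
  have hk' : s - k ≠ 0 := sub_ne_zero.2 (h k hk le_rfl)
  unfold shiftedZetaSum
  refine (DifferentiableAt.fun_sum fun l hl => ?_).neg.add
    ((differentiableAt_const _).div (by fun_prop) hk')
  rw [Finset.mem_Icc] at hl
  refine ((differentiableAt_const _).div ?_ ?_).mul ?_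
  · exact DifferentiableAt.fun_finsetProd fun i _ => by fun_prop
  · refine Finset.prod_ne_zero_iff.2 fun i hi => ?_
    rw [Finset.mem_range] at hi
    have := sub_ne_zero.2 (h (l - i) (by omega) (by omega))
    rwa [Nat.cast_sub hi.le, sub_sub_eq_add_sub, add_sub_right_comm] at this
  · refine (differentiableAt_riemannZeta ?_).comp s (by fun_prop)
    intro hl1
    exact h (l + 1) (by omega) (by omega) (by push_cast; linear_combination hl1)

lemma mellin_expMoment_mul_boseKernel (k : ℕ) {s : ℂ} (hs : 1 < s.re)
    (h : ∀ j : ℕ, 1 ≤ j → j ≤ k + 1 → s ≠ j) :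
    (k + 1) * mellin (fun t => ((expMoment k t * boseKernel t : ℝ) : ℂ)) s =
      Complex.Gamma s * shiftedZetaSum (k + 1) s := by
  set F : ℂ → ℂ := fun s => (k + 1) * mellin (fun t => ((expMoment k t * boseKernel t : ℝ) : ℂ)) s
    with hF
  set G : ℂ → ℂ := fun s => Complex.Gamma s * shiftedZetaSum (k + 1) s with hG
  have hFd : ∀ z : ℂ, 1 < z.re → DifferentiableAt ℂ F z := fun z hz =>
    (differentiableAt_const _).mul (differentiableAt_mellin_of_le_boseKernel
      (continuousOn_expMoment_mul_boseKernel k) (abs_expMoment_mul_boseKernel_le k) hz)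
  have hGd : ∀ z : ℂ, 1 < z.re → (∀ j : ℕ, 1 ≤ j → j ≤ k + 1 → z ≠ j) →
      DifferentiableAt ℂ G z := fun z hz hzj =>
    (Complex.differentiableAt_Gamma z fun m hm => by
      rw [hm] at hz; simp at hz; linarith [(m.cast_nonneg : (0:ℝ) ≤ m)]).mul
      (differentiableAt_shiftedZetaSum _ hzj (by omega))
  have hne : ∀ z : ℂ, z.im ≠ 0 → ∀ j : ℕ, 1 ≤ j → j ≤ k + 1 → z ≠ j := by
    rintro z hz j - - rfl; simp at hz
  have eq_off_real : ∀ ε : ℝ, ε ≠ 0 → ∀ z : ℂ, 1 < z.re → 0 < ε * z.im → F z = G z := by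
    intro ε hε z hz1 hz2
    let U : Set ℂ := {z | 1 < z.re} ∩ {z | 0 < ε * z.im}
    have hU : IsOpen U := (isOpen_lt continuous_const Complex.continuous_re).inter
      (isOpen_lt continuous_const (continuous_const.mul Complex.continuous_im))
    have hconv : Convex ℝ U := by
      refine (convex_halfSpace_re_gt 1).inter ?_
      exact convex_halfSpace_gt (f := fun z : ℂ => ε * z.im)
        ⟨fun x y => by simp [mul_add], fun c x => by simp; ring⟩ 0
    have him : ∀ w ∈ U, w.im ≠ 0 := fun w hw h0 => by
      have := hw.2; simp [h0] at this
    have hFa : AnalyticOnNhd ℂ F U := DifferentiableOn.analyticOnNhd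
      (fun w hw => (hFd w hw.1).differentiableWithinAt) hU
    have hGa : AnalyticOnNhd ℂ G U := DifferentiableOn.analyticOnNhd
      (fun w hw => (hGd w hw.1 (hne w (him w hw))).differentiableWithinAt) hU
    let z₀ : ℂ := ⟨k + 2, ε⟩
    have hz₀ : z₀ ∈ U := ⟨by simp [z₀]; linarith [(k.cast_nonneg : (0:ℝ) ≤ k)],
      by simp [z₀]; positivity⟩
    refine hFa.eqOn_of_preconnected_of_eventuallyEq hGa hconv.isPreconnected hz₀ ?_ ⟨hz1, hz2⟩
    filter_upwards [(isOpen_lt continuous_const Complex.continuous_re).mem_nhds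
      (show (k + 1 : ℝ) < z₀.re by simp [z₀])] with w hw
    exact mellin_expMoment_mul_boseKernel_of_lt k hw
  rcases eq_or_ne s.im 0 with h0 | h0
  · have ht : Tendsto (fun ε : ℝ => s + ε * Complex.I) (𝓝[>] 0) (𝓝 s) := by
      have : Continuous fun ε : ℝ => s + ε * Complex.I := by fun_prop
      simpa using (this.tendsto 0).mono_left nhdsWithin_le_nhds
    refine tendsto_nhds_unique_of_eventuallyEq ((hFd s hs).continuousAt.tendsto.comp ht)
      ((hGd s hs h).continuousAt.tendsto.comp ht) ?_
    filter_upwards [self_mem_nhdsWithin] with ε hε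
    exact eq_off_real 1 one_ne_zero _ (by simpa using hs) (by simpa [h0] using hε)
  · exact eq_off_real s.im h0 s hs (mul_self_pos.2 h0)

lemma hasSum_binomial_one_sub_rpow {u : ℝ} (hu : |u| < 1) (x : ℝ) :
    HasSum (fun n : ℕ => (∏ i ∈ Finset.range n, (x - (i : ℝ))) / n.factorial * (-u) ^ n)
      ((1 - u) ^ x) := by
  have h := (Real.one_add_rpow_hasFPowerSeriesOnBall_zero (a := x)).hasSum (y := -u)
    (by simpa [enorm_eq_nnnorm, ← NNReal.coe_lt_coe] using hu)
  rw [zero_add, ← sub_eq_add_neg] at h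
  convert! h using 2 with n
  rw [binomialSeries_apply, Ring.choose_eq_smul, ← Polynomial.aeval_eq_smeval, Polynomial.aeval_def,
    Polynomial.eval₂_eq_eval_map, descPochhammer_map,
    descPochhammer_eval_eq_prod_range]
  simp [div_eq_inv_mul]

lemma neg_one_pow_mul_prod_nonneg (n : ℕ) {x : ℝ} (h0 : 0 ≤ x) (h1 : x ≤ 1) :
    0 ≤ (-1) ^ n * ∏ i ∈ Finset.range (n + 1), (x - (i : ℝ)) := by
  induction n with
  | zero => simpa using h0
  | succ n ih =>
    rw [Finset.prod_range_succ, pow_succ]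
    have : 0 ≤ ((n + 1 : ℕ) : ℝ) - x := by
      push_cast; linarith [(n.cast_nonneg : (0:ℝ) ≤ n)]
    nlinarith [mul_nonneg ih this]

lemma hasSum_binomial_quotient {u : ℝ} (h0 : 0 < u) (h1 : u < 1) (x : ℝ) :
    HasSum (fun n : ℕ => (-1) ^ n * (∏ i ∈ Finset.range (n + 1), (x - (i : ℝ))) /
      (n + 1).factorial * u ^ n) ((1 - (1 - u) ^ x) / u) := by
  have h := (hasSum_nat_add_iff' 1).2
    (hasSum_binomial_one_sub_rpow (by rwa [abs_of_pos h0]) x : HasSum _ ((1 - u) ^ x))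
  convert! h.mul_right (-u⁻¹) using 1
  · ext n
    rw [neg_pow u (n + 1), pow_succ, pow_succ u]
    field_simp
  · simp; field_simp; ring

lemma neg_one_pow_mul_gregoryGk_nonneg (n k : ℕ) : 0 ≤ (-1) ^ n * gregoryGk (n + 1) k := by
  rw [gregoryGk, ← intervalIntegral.integral_const_mul]
  refine intervalIntegral.integral_nonneg zero_le_one fun x hx => ?_
  have := mul_nonneg (pow_nonneg hx.1 (k - 1)) (neg_one_pow_mul_prod_nonneg n hx.1 hx.2)
  rw [mul_div_assoc', mul_left_comm]
  positivity

/-- The generating function of the higher Gregory coefficients at `u = 1 - e^{-t}`. -/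
lemma hasSum_gregoryGk (k : ℕ) {t : ℝ} (ht : 0 < t) :
    HasSum (fun n : ℕ => (-1) ^ n * gregoryGk (n + 1) (k + 1) * (1 - Real.exp (-t)) ^ n)
      ((1 / (k + 1) - expMoment k t) / (1 - Real.exp (-t))) := by
  set u := 1 - Real.exp (-t) with hu
  have hu0 : 0 < u := by
    have : Real.exp (-t) < 1 := Real.exp_lt_one_iff.2 (by linarith)
    linarith
  have hu1 : u < 1 := by linarith [Real.exp_pos (-t)]
  have hlim (x : ℝ) : HasSum (fun n : ℕ => x ^ k * ((-1) ^ n *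
      (∏ i ∈ Finset.range (n + 1), (x - (i : ℝ))) / (n + 1).factorial * u ^ n))
      (x ^ k * ((1 - Real.exp (-(x * t))) / u)) := by
    have := (hasSum_binomial_quotient hu0 hu1 x).mul_left (x ^ k)
    rwa [show (1 - u) ^ x = Real.exp (-(x * t)) by
      rw [hu, sub_sub_cancel, ← Real.exp_mul]; ring_nf] at this
  have key := intervalIntegral.hasSum_integral_of_dominated_convergence (μ := volume)
    (a := 0) (b := 1)
    (F := fun (n : ℕ) (x : ℝ) => x ^ k * ((-1) ^ n *
      (∏ i ∈ Finset.range (n + 1), (x - (i : ℝ))) / (n + 1).factorial * u ^ n))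
    (f := fun x => x ^ k * ((1 - Real.exp (-(x * t))) / u))
    (fun n x => x ^ k * ((-1) ^ n *
      (∏ i ∈ Finset.range (n + 1), (x - (i : ℝ))) / (n + 1).factorial * u ^ n))
    (fun n => by apply Continuous.aestronglyMeasurable; fun_prop)
    (fun n => ae_of_all _ fun x hx => by
      rw [uIoc_of_le zero_le_one] at hx
      have := neg_one_pow_mul_prod_nonneg n hx.1.le hx.2
      have := hx.1.le
      rw [Real.norm_eq_abs, abs_of_nonneg (by positivity)])
    (ae_of_all _ fun x _ => (hlim x).summable)
    (by
      simp only [(hlim _).tsum_eq]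
      apply Continuous.intervalIntegrable
      fun_prop)
    (ae_of_all _ fun x _ => hlim x)
  convert! key using 1
  · ext n
    rw [gregoryGk, ← intervalIntegral.integral_const_mul, ← intervalIntegral.integral_mul_const]
    congr 1; ext x
    simp only [Nat.add_sub_cancel]
    ring
  · have : ∫ x in (0:ℝ)..1, x ^ k = 1 / (k + 1) := by simp
    rw [← this, expMoment, ← intervalIntegral.integral_sub
      (by apply Continuous.intervalIntegrable; fun_prop)
      (by apply Continuous.intervalIntegrable; fun_prop), ← intervalIntegral.integral_div]
    congr 1; ext x; ring

lemma mellin_exp_mul_one_sub_exp_pow (n : ℕ) {s : ℂ} (hs : 0 < s.re) :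
    mellin (fun t => ((Real.exp (-t) * (1 - Real.exp (-t)) ^ n : ℝ) : ℂ)) s =
      Complex.Gamma s *
        ∑ j ∈ Finset.range (n + 1), (-1) ^ j * (n.choose j : ℂ) * ((j : ℂ) + 1) ^ (-s) := by
  have h := hasSum_mellin (ι := Fin (n + 1)) (a := fun j => (-1) ^ (j : ℕ) * (n.choose j : ℂ))
    (p := fun j => (j : ℝ) + 1) (s := s)
    (F := fun t => ((Real.exp (-t) * (1 - Real.exp (-t)) ^ n : ℝ) : ℂ))
    (fun j => Or.inr (by positivity)) hs
    (fun t _ => by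
      have e : (Real.exp (-t) * (1 - Real.exp (-t)) ^ n : ℝ) = ∑ j ∈ Finset.range (n + 1),
          (-1) ^ j * (n.choose j : ℝ) * Real.exp (-(j + 1) * t) := by
        rw [sub_eq_neg_add, add_pow, Finset.mul_sum]
        refine Finset.sum_congr rfl fun j _ => ?_
        rw [neg_pow, ← Real.exp_nat_mul, show -((j : ℝ) + 1) * t = -t + j * -t by ring,
          Real.exp_add]
        ring
      rw [e, ← Fin.sum_univ_eq_sum_range]
      push_cast
      exact hasSum_fintype _)
    (hasSum_fintype _).summable
  rw [h.unique (hasSum_fintype _), Fin.sum_univ_eq_sum_range (fun j : ℕ => Complex.Gamma s *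
    ((-1) ^ j * (n.choose j : ℂ)) / (((j : ℝ) + 1 : ℝ) : ℂ) ^ s), Finset.mul_sum]
  refine Finset.sum_congr rfl fun j _ => ?_
  rw [Complex.cpow_neg]
  push_cast
  ring

/-- Termwise Mellin transform of the Gregory generating function. -/
lemma hasSum_mellin_gregoryGk (k : ℕ) {s : ℂ} (hs : 1 < s.re) :
    HasSum (fun n : ℕ => Complex.Gamma s * ((-1) ^ n * (gregoryGk (n + 1) (k + 1) : ℂ) *
        ∑ j ∈ Finset.range (n + 1), (-1) ^ j * (n.choose j : ℂ) * ((j : ℂ) + 1) ^ (-s)))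
      (mellin (fun t => (((1 / (k + 1) - expMoment k t) * boseKernel t : ℝ) : ℂ)) s) := by
  have hlim (t : ℝ) (ht : 0 < t) : HasSum (fun n : ℕ => (-1) ^ n * gregoryGk (n + 1) (k + 1) *
      (Real.exp (-t) * (1 - Real.exp (-t)) ^ n)) ((1 / (k + 1) - expMoment k t) * boseKernel t) := by
    convert! (hasSum_gregoryGk k ht).mul_left (Real.exp (-t)) using 1
    · ext n; ring
    · rw [boseKernel_eq_exp_div ht]; ring
  have hnn (n : ℕ) (t : ℝ) (ht : 0 < t) : 0 ≤ (-1) ^ n * gregoryGk (n + 1) (k + 1) *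
      (Real.exp (-t) * (1 - Real.exp (-t)) ^ n) := by
    have : Real.exp (-t) < 1 := Real.exp_lt_one_iff.2 (by linarith)
    have : 0 ≤ 1 - Real.exp (-t) := by linarith
    exact mul_nonneg (neg_one_pow_mul_gregoryGk_nonneg n _) (by positivity)
  have hb (t : ℝ) (ht : 0 < t) :
      |(1 / (k + 1) - expMoment k t) * boseKernel t| ≤ 1 / (k + 1) * boseKernel t := by
    have h := boseKernel_pos ht
    rw [abs_of_nonneg (mul_nonneg (sub_nonneg.2 (expMoment_le k ht)) h.le)]
    exact mul_le_mul_of_nonneg_right (sub_le_self _ (expMoment_nonneg k t)) h.le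
  have hconv : MellinConvergent
      (fun t => (((1 / (k + 1) - expMoment k t) * boseKernel t : ℝ) : ℂ)) s :=
    mellinConvergent_of_le_boseKernel
      ((continuous_const.sub (continuous_expMoment k)).continuousOn.mul continuousOn_boseKernel)
      hb hs
  have key := MeasureTheory.hasSum_integral_of_dominated_convergence
    (μ := volume.restrict (Ioi (0:ℝ)))
    (F := fun (n : ℕ) (t : ℝ) => (t : ℂ) ^ (s - 1) • (((-1) ^ n * gregoryGk (n + 1) (k + 1) *
      (Real.exp (-t) * (1 - Real.exp (-t)) ^ n) : ℝ) : ℂ))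
    (f := fun t => (t : ℂ) ^ (s - 1) •
      (((1 / (k + 1) - expMoment k t) * boseKernel t : ℝ) : ℂ))
    (fun n t => ‖(t : ℂ) ^ (s - 1)‖ * ((-1) ^ n * gregoryGk (n + 1) (k + 1) *
      (Real.exp (-t) * (1 - Real.exp (-t)) ^ n)))
    (fun n => by
      refine ContinuousOn.aestronglyMeasurable (ContinuousOn.fun_smul (fun t ht => ?_) ?_)
        measurableSet_Ioi
      · exact (Complex.continuousAt_ofReal_cpow_const _ _ (Or.inr (ne_of_gt ht))).continuousWithinAt
      · fun_prop)
    (fun n => (ae_restrict_iff' measurableSet_Ioi).2 <| ae_of_all _ fun t ht => by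
      rw [norm_smul, Complex.norm_real, Real.norm_eq_abs, abs_of_nonneg (hnn n t ht)])
    ((ae_restrict_iff' measurableSet_Ioi).2 <| ae_of_all _ fun t ht =>
      ((hlim t ht).mul_left _).summable)
    (by
      refine (integrable_congr ?_).1 hconv.norm
      refine (ae_restrict_iff' measurableSet_Ioi).2 <| ae_of_all _ fun t ht => ?_
      simp only
      rw [((hlim t ht).mul_left _).tsum_eq, norm_smul, Complex.norm_real, Real.norm_eq_abs,
        abs_of_nonneg ((hlim t ht).nonneg fun n => hnn n t ht)])
    ((ae_restrict_iff' measurableSet_Ioi).2 <| ae_of_all _ fun t ht =>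
      (Complex.hasSum_ofReal.2 (hlim t ht)).const_smul _)
  convert! key using 1
  ext n
  rw [mul_left_comm, ← mellin_exp_mul_one_sub_exp_pow n (by linarith), ← smul_eq_mul,
    ← mellin_const_smul, mellin]
  congr 1; ext t
  simp

lemma mellin_sub_expMoment_mul_boseKernel (k : ℕ) {s : ℂ} (hs : 1 < s.re)
    (h : ∀ j : ℕ, 1 ≤ j → j ≤ k + 1 → s ≠ j) :
    (k + 1) * mellin (fun t => (((1 / (k + 1) - expMoment k t) * boseKernel t : ℝ) : ℂ)) s =
      Complex.Gamma s * (riemannZeta s - shiftedZetaSum (k + 1) s) := by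
  have h2 : ∀ t, 0 < t → |boseKernel t| ≤ 1 * boseKernel t := fun t ht => by
    rw [abs_of_pos (boseKernel_pos ht), one_mul]
  have hk : (k + 1 : ℂ) ≠ 0 := by exact_mod_cast k.succ_ne_zero
  have hM := (hasMellin_sub ((mellinConvergent_of_le_boseKernel continuousOn_boseKernel h2
    hs).const_smul (1 / (k + 1) : ℂ)) (mellinConvergent_of_le_boseKernel
      (continuousOn_expMoment_mul_boseKernel k) (abs_expMoment_mul_boseKernel_le k) hs)).2
  rw [mellin_const_smul, mellin_boseKernel hs] at hM
  have e : (fun t => (((1 / (k + 1) - expMoment k t) * boseKernel t : ℝ) : ℂ)) = fun t =>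
      (1 / (k + 1) : ℂ) • (boseKernel t : ℂ) - ((expMoment k t * boseKernel t : ℝ) : ℂ) := by
    ext t; push_cast; simp; ring
  rw [e, hM, mul_sub, mellin_expMoment_mul_boseKernel k hs h, smul_eq_mul]
  field_simp

/-- Functional relationship for the zeta function with Gregory's coefficients of higher
order: for an integer `k ≥ 2` and complex `s` with `Re s > 1` and `s ∉ {2, 3, …, k}`,
`ζ(s) = −Σ_{l=1}^{k−1} ((k−l+1)⋯k)/((s−l)⋯(s−1)) · ζ(s−l) + k/(s−k)
  + k Σ_{n=0}^∞ (−1)^n G_{n+1}^{(k)} Σ_{j=0}^n (−1)^j C(n,j) (j+1)^{−s}`,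
the outer infinite series being convergent. -/
theorem zeta_higher_gregory_relation (k : ℕ) (hk : 2 ≤ k) (s : ℂ) (hs : 1 < s.re)
    (hs' : ∀ j : ℕ, 2 ≤ j → j ≤ k → s ≠ (j : ℂ)) :
    ∃ L : ℂ,
      Tendsto (fun N : ℕ => ∑ n ∈ Finset.range N,
          (-1) ^ n * (Complex.ofReal (gregoryGk (n + 1) k)) *
          ∑ j ∈ Finset.range (n + 1), (-1) ^ j * (n.choose j : ℂ) * ((j : ℂ) + 1) ^ (-s))
        atTop (nhds L) ∧
      riemannZeta s =
        -(∑ l ∈ Finset.Icc 1 (k - 1),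
            (∏ i ∈ Finset.range l, ((k : ℂ) - (l : ℂ) + 1 + (i : ℂ))) /
              (∏ i ∈ Finset.range l, (s - (l : ℂ) + (i : ℂ))) * riemannZeta (s - (l : ℂ)))
          + (k : ℂ) / (s - (k : ℂ)) + (k : ℂ) * L := by
  obtain ⟨k, rfl⟩ : ∃ m, k = m + 1 := ⟨k - 1, by omega⟩
  have hne : ∀ j : ℕ, 1 ≤ j → j ≤ k + 1 → s ≠ j := fun j h1 h2 => by
    rcases h1.eq_or_lt with rfl | h1
    · rintro rfl; simp at hs
    · exact hs' j h1 h2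
  have hΓ : Complex.Gamma s ≠ 0 := Complex.Gamma_ne_zero_of_re_pos (by linarith)
  have hsum := (hasSum_mellin_gregoryGk k hs).mul_left (Complex.Gamma s)⁻¹
  simp only [inv_mul_cancel_left₀ hΓ] at hsum
  refine ⟨_, hsum.tendsto_sum_nat, ?_⟩
  change riemannZeta s = shiftedZetaSum (k + 1) s + _
  rw [mul_left_comm]
  rw [Nat.cast_add_one]
  rw [mellin_sub_expMoment_mul_boseKernel k hs hne, inv_mul_cancel_left₀ hΓ]
  ring
end

section
/- Let s and v be complex numbers with Re s > 2 and Re v > 0. Then (v − 1/2) · Σ_{n=0}^∞ (n+v)^{−s} = ((s−2)/(s−1)) · Σ_{n=0}^∞ (n+v)^{1−s} + Σ_{n=0}^∞ (−1)^n G_{n+2} Σ_{k=0}^n (−1)^k C(n,k) (k+v)^{−s}, the last series being convergent. -/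
open Filter Finset intervalIntegral

/-- Gregory's coefficients `G_n = ∫₀¹ x(x−1)⋯(x−n+1)/n! dx`. -/
noncomputable def gregoryG (n : ℕ) : ℝ :=
  ∫ x in (0:ℝ)..1, (∏ i ∈ Finset.range n, (x - (i : ℝ))) / (n.factorial : ℝ)

open MeasureTheory Set Topology

/-- The integrand of the Gamma integral, rescaled by a complex parameter `u`. -/
noncomputable def gammaKernel (z u : ℂ) (t : ℝ) : ℂ :=
  (t : ℂ) ^ (z - 1) * Complex.exp (-(u * t))

lemma norm_gammaKernel (z u : ℂ) {t : ℝ} (ht : 0 < t) :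
    ‖gammaKernel z u t‖ = t ^ (z.re - 1) * Real.exp (-(u.re * t)) := by
  simp [gammaKernel, Complex.norm_cpow_eq_rpow_re_of_pos ht, Complex.norm_exp]

lemma continuousOn_gammaKernel (z u : ℂ) : ContinuousOn (gammaKernel z u) (Ioi 0) := by
  intro t ht
  have h : ContinuousAt (fun t : ℝ => (t : ℂ) ^ (z - 1)) t :=
    Complex.continuousAt_ofReal_cpow_const _ _ (Or.inr (ne_of_gt ht))
  unfold gammaKernel
  exact (h.mul (by fun_prop)).continuousWithinAt

lemma aestronglyMeasurable_gammaKernel (z u : ℂ) :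
    AEStronglyMeasurable (gammaKernel z u) (volume.restrict (Ioi 0)) :=
  (continuousOn_gammaKernel z u).aestronglyMeasurable measurableSet_Ioi

lemma integrableOn_rpow_mul_exp_neg_mul {a r : ℝ} (ha : 0 < a) (hr : 0 < r) :
    IntegrableOn (fun t : ℝ => t ^ (a - 1) * Real.exp (-(r * t))) (Ioi 0) := by
  refine .of_integral_ne_zero ?_
  rw [Real.integral_rpow_mul_exp_neg_mul_Ioi ha hr]
  have := Real.Gamma_pos_of_pos ha
  positivity

lemma integrableOn_gammaKernel {z u : ℂ} (hz : 0 < z.re) (hu : 0 < u.re) :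
    IntegrableOn (gammaKernel z u) (Ioi 0) := by
  refine Integrable.mono' (integrableOn_rpow_mul_exp_neg_mul hz hu)
    (aestronglyMeasurable_gammaKernel z u) ?_
  filter_upwards [ae_restrict_mem measurableSet_Ioi] with t ht
  exact (norm_gammaKernel z u ht).le

lemma integral_norm_gammaKernel {z u : ℂ} (hz : 0 < z.re) (hu : 0 < u.re) :
    ∫ t in Ioi (0 : ℝ), ‖gammaKernel z u t‖ = u.re ^ (-z.re) * Real.Gamma z.re := by
  rw [setIntegral_congr_fun measurableSet_Ioi (fun t ht => norm_gammaKernel z u ht),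
    Real.integral_rpow_mul_exp_neg_mul_Ioi hz hu, one_div, Real.inv_rpow hu.le,
    Real.rpow_neg hu.le]

lemma hasDerivAt_integral_gammaKernel {z u : ℂ} (hz : 0 < z.re) (hu : 0 < u.re) :
    HasDerivAt (fun u => ∫ t in Ioi (0 : ℝ), gammaKernel z u t)
      (∫ t in Ioi (0 : ℝ), -(t : ℂ) * gammaKernel z u t) u := by
  have hU : {w : ℂ | u.re / 2 < w.re} ∈ 𝓝 u :=
    (isOpen_lt continuous_const Complex.continuous_re).mem_nhds (by simp; linarith)
  refine (hasDerivAt_integral_of_dominated_loc_of_deriv_le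
    (F' := fun w t => -(t : ℂ) * gammaKernel z w t)
    (bound := fun t : ℝ => t ^ ((z.re + 1) - 1) * Real.exp (-(u.re / 2 * t))) hU
    (Eventually.of_forall fun w => aestronglyMeasurable_gammaKernel z w)
    (integrableOn_gammaKernel hz hu) ?_ ?_
    (integrableOn_rpow_mul_exp_neg_mul (by linarith) (by linarith)) ?_).2
  · exact AEStronglyMeasurable.mul (by fun_prop) (aestronglyMeasurable_gammaKernel z u)
  · filter_upwards [ae_restrict_mem measurableSet_Ioi] with t ht w hw
    have ht' : 0 < t := ht
    have hw' : u.re / 2 < w.re := hw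
    rw [norm_mul, norm_gammaKernel z w ht, ← mul_assoc]
    have : ‖-(t : ℂ)‖ * t ^ (z.re - 1) = t ^ (z.re + 1 - 1) := by
      rw [norm_neg, Complex.norm_real, Real.norm_of_nonneg ht'.le, Real.rpow_sub_one ht'.ne']
      field_simp
      ring_nf
    rw [this]
    gcongr
  · refine Eventually.of_forall fun t w _ => ?_
    have h : HasDerivAt (fun w : ℂ => -(w * (t : ℂ))) (-(1 * (t : ℂ))) w :=
      ((hasDerivAt_id w).mul_const _).neg
    convert! (h.cexp.const_mul ((t : ℂ) ^ (z - 1))) using 1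
    unfold gammaKernel
    ring

lemma integral_gammaKernel {z u : ℂ} (hz : 0 < z.re) (hu : 0 < u.re) :
    ∫ t in Ioi (0 : ℝ), gammaKernel z u t = u ^ (-z) * Complex.Gamma z := by
  have hopen : IsOpen {w : ℂ | 0 < w.re} := isOpen_lt continuous_const Complex.continuous_re
  have hF : AnalyticOnNhd ℂ (fun u => ∫ t in Ioi (0 : ℝ), gammaKernel z u t) {w : ℂ | 0 < w.re} :=
    DifferentiableOn.analyticOnNhd (fun w hw =>
      (hasDerivAt_integral_gammaKernel hz hw).differentiableAt.differentiableWithinAt) hopen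
  have hG : AnalyticOnNhd ℂ (fun u : ℂ => u ^ (-z) * Complex.Gamma z) {w : ℂ | 0 < w.re} :=
    DifferentiableOn.analyticOnNhd (fun w hw =>
      ((differentiableAt_id.cpow_const (Or.inl hw)).mul_const _).differentiableWithinAt) hopen
  refine hF.eqOn_of_preconnected_of_frequently_eq hG
    (convex_halfSpace_re_gt 0).isPreconnected (z₀ := 1) (by simp) ?_ hu
  have htend : Tendsto (fun r : ℝ => (r : ℂ)) (𝓝[≠] 1) (𝓝[≠] 1) := by
    refine tendsto_nhdsWithin_iff.2 ⟨?_, ?_⟩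
    · exact (Complex.continuous_ofReal.tendsto' 1 1 (by simp)).mono_left nhdsWithin_le_nhds
    · filter_upwards [self_mem_nhdsWithin] with r hr
      simpa using hr
  refine htend.frequently (Eventually.frequently ?_)
  filter_upwards [nhdsWithin_le_nhds (lt_mem_nhds (zero_lt_one' ℝ))] with r hr
  have h := Complex.integral_cpow_mul_exp_neg_mul_Ioi hz hr
  rw [one_div, Complex.inv_cpow _ _ (by
    rw [Complex.arg_ofReal_of_nonneg hr.le]; exact Real.pi_pos.ne), ← Complex.cpow_neg] at h
  exact h

lemma summable_nat_add_rpow_neg {x σ : ℝ} (hx : 0 < x) (hσ : 1 < σ) :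
    Summable fun n : ℕ => ((n : ℝ) + x) ^ (-σ) := by
  refine ((Real.summable_one_div_nat_add_rpow x σ).2 hσ).congr fun n => ?_
  have : 0 < (n : ℝ) + x := by positivity
  rw [abs_of_pos this, Real.rpow_neg this.le, one_div]

lemma nat_add_re_pos {v : ℂ} (hv : 0 < v.re) (n : ℕ) : 0 < ((n : ℂ) + v).re := by
  simp only [Complex.add_re, Complex.natCast_re]
  positivity

lemma summable_nat_add_cpow_neg {v z : ℂ} (hv : 0 < v.re) (hz : 1 < z.re) :
    Summable fun n : ℕ => ((n : ℂ) + v) ^ (-z) := by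
  have hz0 : 0 < z.re := by linarith
  have hΓ : Complex.Gamma z ≠ 0 := Complex.Gamma_ne_zero_of_re_pos hz0
  suffices h : Summable fun n : ℕ => ((n : ℂ) + v) ^ (-z) * Complex.Gamma z from
    (summable_mul_right_iff hΓ).1 h
  refine Summable.of_norm_bounded
    ((summable_nat_add_rpow_neg hv hz).mul_right (Real.Gamma z.re)) fun n => ?_
  rw [← integral_gammaKernel hz0 (nat_add_re_pos hv n)]
  refine (MeasureTheory.norm_integral_le_integral_norm _).trans_eq ?_
  rw [integral_norm_gammaKernel hz0 (nat_add_re_pos hv n), Complex.add_re, Complex.natCast_re]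

lemma gammaKernel_mul_exp_pow (z u : ℂ) (t : ℝ) (k : ℕ) :
    gammaKernel z u t * ((Real.exp (-t) : ℝ) : ℂ) ^ k = gammaKernel z ((k : ℂ) + u) t := by
  unfold gammaKernel
  rw [Complex.ofReal_exp, ← Complex.exp_nat_mul, mul_assoc, ← Complex.exp_add]
  congr 2
  push_cast
  ring

lemma gammaKernel_sub_one (z u : ℂ) {t : ℝ} (ht : 0 < t) :
    gammaKernel (z - 1) u t = gammaKernel z u t / t := by
  unfold gammaKernel
  rw [Complex.cpow_sub (z - 1) 1 (by exact_mod_cast ht.ne'), Complex.cpow_one]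
  ring

/-- Finite differences of `u ↦ u ^ (-z)` as a Laplace-type integral. -/
lemma integral_gammaKernel_mul_one_sub_exp_pow {z u : ℂ} (hz : 0 < z.re) (hu : 0 < u.re) (n : ℕ) :
    ∫ t in Ioi (0 : ℝ), gammaKernel z u t * ((1 - Real.exp (-t) : ℝ) : ℂ) ^ n =
      (∑ k ∈ Finset.range (n + 1), (-1) ^ k * (n.choose k : ℂ) * ((k : ℂ) + u) ^ (-z)) *
        Complex.Gamma z := by
  have h (t : ℝ) : gammaKernel z u t * ((1 - Real.exp (-t) : ℝ) : ℂ) ^ n =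
      ∑ k ∈ Finset.range (n + 1), (-1) ^ k * (n.choose k : ℂ) * gammaKernel z ((k : ℂ) + u) t := by
    rw [Complex.ofReal_sub, sub_eq_neg_add, add_pow, Finset.mul_sum]
    refine Finset.sum_congr rfl fun k _ => ?_
    rw [← gammaKernel_mul_exp_pow, neg_pow]
    simp
    ring
  simp_rw [h]
  rw [integral_finsetSum _ fun k _ =>
    (integrableOn_gammaKernel hz (nat_add_re_pos hu k)).const_mul _, Finset.sum_mul]
  refine Finset.sum_congr rfl fun k _ => ?_
  rw [MeasureTheory.integral_const_mul, integral_gammaKernel hz (nat_add_re_pos hu k)]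
  ring

lemma ring_choose_eq_prod_div (x : ℝ) (n : ℕ) :
    Ring.choose x n = (∏ i ∈ Finset.range n, (x - (i : ℝ))) / (n.factorial : ℝ) := by
  rw [Ring.choose_eq_smul, ← descPochhammer_eval_eq_prod_range, smul_eq_mul, inv_mul_eq_div,
    ← descPochhammer_map (algebraMap ℤ ℝ), Polynomial.eval_map_algebraMap,
    Polynomial.aeval_eq_smeval]

lemma continuous_prod_sub_div (n : ℕ) :
    Continuous fun x : ℝ => (∏ i ∈ Finset.range n, (x - (i : ℝ))) / (n.factorial : ℝ) := by
  fun_prop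

lemma abs_prod_sub_div_le_one {x : ℝ} (hx : x ∈ Icc (0 : ℝ) 1) (n : ℕ) :
    |(∏ i ∈ Finset.range n, (x - (i : ℝ))) / (n.factorial : ℝ)| ≤ 1 := by
  rw [abs_div, Nat.abs_cast, div_le_one (by positivity), Finset.abs_prod,
    ← Finset.prod_range_add_one_eq_factorial]
  push_cast
  refine Finset.prod_le_prod (fun _ _ => abs_nonneg _) fun i _ => ?_
  have : (0 : ℝ) ≤ i := by positivity
  rw [abs_le]
  constructor <;> linarith [hx.1, hx.2]

lemma hasSum_prod_sub_div_mul_neg_pow {w : ℝ} (hw0 : 0 ≤ w) (hw1 : w < 1) (x : ℝ) :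
    HasSum (fun n : ℕ => (∏ i ∈ Finset.range n, (x - (i : ℝ))) / (n.factorial : ℝ) * (-w) ^ n)
      ((1 - w) ^ x) := by
  have h := (Real.one_add_rpow_hasFPowerSeriesOnBall_zero (a := x)).hasSum (y := -w) (by
    simpa [Metric.mem_eball, edist_zero_right, enorm_eq_nnnorm, ← NNReal.coe_lt_coe,
      abs_of_nonneg hw0] using hw1)
  simpa [-FormalMultilinearSeries.apply_eq_prod_smul_coeff, binomialSeries_apply,
    ring_choose_eq_prod_div, sub_eq_add_neg] using h

lemma hasSum_gregoryG_mul_neg_pow {w : ℝ} (hw0 : 0 ≤ w) (hw1 : w < 1) :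
    HasSum (fun n : ℕ => gregoryG n * (-w) ^ n) (∫ x in (0 : ℝ)..1, (1 - w) ^ x) := by
  have hsum : Summable fun n : ℕ => w ^ n := summable_geometric_of_lt_one hw0 hw1
  simp only [gregoryG, ← intervalIntegral.integral_mul_const]
  refine intervalIntegral.hasSum_integral_of_dominated_convergence (fun n _ => w ^ n)
    (fun n => ((continuous_prod_sub_div n).mul_const _).aestronglyMeasurable) (fun n => ?_)
    (Eventually.of_forall fun _ _ => hsum) (by simp)
    (Eventually.of_forall fun x _ => hasSum_prod_sub_div_mul_neg_pow hw0 hw1 x)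
  refine Eventually.of_forall fun x hx => ?_
  rw [uIoc_of_le zero_le_one] at hx
  rw [norm_mul, norm_pow, norm_neg, Real.norm_of_nonneg hw0]
  exact mul_le_of_le_one_left (by positivity) (abs_prod_sub_div_le_one (Ioc_subset_Icc_self hx) n)

lemma gregoryG_zero : gregoryG 0 = 1 := by simp [gregoryG]

lemma gregoryG_one : gregoryG 1 = 1 / 2 := by simp [gregoryG]

lemma neg_one_pow_mul_gregoryG_nonpos (n : ℕ) : (-1) ^ n * gregoryG (n + 2) ≤ 0 := by
  unfold gregoryG
  rw [← intervalIntegral.integral_const_mul, ← neg_nonneg, ← intervalIntegral.integral_neg]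
  refine intervalIntegral.integral_nonneg zero_le_one fun x hx => ?_
  rw [Finset.prod_range_succ', Finset.prod_range_succ']
  have h : ∏ k ∈ Finset.range n, (x - ((k + 1 + 1 : ℕ) : ℝ)) =
      (-1) ^ n * ∏ k ∈ Finset.range n, (((k + 1 + 1 : ℕ) : ℝ) - x) := by
    rw [← Finset.card_range n, ← Finset.prod_const, Finset.card_range, ← Finset.prod_mul_distrib]
    exact Finset.prod_congr rfl fun _ _ => by ring
  have hprod : 0 ≤ ∏ k ∈ Finset.range n, (((k + 1 + 1 : ℕ) : ℝ) - x) :=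
    Finset.prod_nonneg fun k _ => by
      push_cast
      have : (0 : ℝ) ≤ k := by positivity
      linarith [hx.2]
  have hsq : ((-1 : ℝ) ^ n) * (-1) ^ n = 1 := by rw [← mul_pow]; simp
  rw [h]
  have hrw : -((-1) ^ n * ((-1) ^ n * (∏ k ∈ Finset.range n, (((k + 1 + 1 : ℕ) : ℝ) - x)) *
      (x - ((0 + 1 : ℕ) : ℝ)) * (x - ((0 : ℕ) : ℝ)) / ((n + 2).factorial : ℝ))) =
      ((-1) ^ n * (-1) ^ n) * ((∏ k ∈ Finset.range n, (((k + 1 + 1 : ℕ) : ℝ) - x)) *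
      ((1 - x) * x) / ((n + 2).factorial : ℝ)) := by
    push_cast
    ring
  rw [hrw, hsq, one_mul]
  have := hx.1
  have : 0 ≤ 1 - x := by linarith [hx.2]
  positivity

lemma hasSum_gregoryG_add_two {w : ℝ} (hw0 : 0 ≤ w) (hw1 : w < 1) :
    HasSum (fun n : ℕ => (-1) ^ n * gregoryG (n + 2) * w ^ (n + 2))
      ((∫ x in (0 : ℝ)..1, (1 - w) ^ x) - 1 + w / 2) := by
  have h := (hasSum_nat_add_iff' 2).2 (hasSum_gregoryG_mul_neg_pow hw0 hw1)
  convert! h using 1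
  · funext n
    rw [neg_pow w]
    ring
  · simp [Finset.sum_range_succ, gregoryG_zero, gregoryG_one]
    ring

lemma summable_abs_gregoryG_add_two : Summable fun n : ℕ => |gregoryG (n + 2)| := by
  have habs (n : ℕ) : |gregoryG (n + 2)| = -((-1) ^ n * gregoryG (n + 2)) := by
    rw [← abs_of_nonpos (neg_one_pow_mul_gregoryG_nonpos n), abs_mul]
    simp
  refine summable_of_sum_range_le (c := 1) (fun _ => abs_nonneg _) fun N => ?_
  have hlim : Tendsto (fun w : ℝ => ∑ n ∈ Finset.range N, |gregoryG (n + 2)| * w ^ (n + 2))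
      (𝓝[<] 1) (𝓝 (∑ n ∈ Finset.range N, |gregoryG (n + 2)|)) := by
    refine (Continuous.tendsto' (by fun_prop) _ _ (by simp)).mono_left nhdsWithin_le_nhds
  refine le_of_tendsto hlim ?_
  filter_upwards [Ioo_mem_nhdsLT (zero_lt_one' ℝ)] with w hw
  have h := (hasSum_gregoryG_add_two hw.1.le hw.2).neg
  have hle := sum_le_hasSum (Finset.range N) (fun n _ => by
    have := neg_one_pow_mul_gregoryG_nonpos n
    have h2 : 0 ≤ w ^ (n + 2) := pow_nonneg hw.1.le _
    nlinarith) h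
  have hint : 0 ≤ ∫ x in (0 : ℝ)..1, (1 - w) ^ x :=
    intervalIntegral.integral_nonneg zero_le_one fun x _ =>
      Real.rpow_nonneg (by linarith [hw.2]) x
  calc ∑ n ∈ Finset.range N, |gregoryG (n + 2)| * w ^ (n + 2)
      = ∑ n ∈ Finset.range N, -((-1) ^ n * gregoryG (n + 2) * w ^ (n + 2)) :=
        Finset.sum_congr rfl fun n _ => by rw [habs, neg_mul]
    _ ≤ _ := hle
    _ ≤ 1 := by linarith [hw.1]

lemma integral_exp_neg_rpow_unitInterval {t : ℝ} (ht : 0 < t) :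
    ∫ x in (0 : ℝ)..1, Real.exp (-t) ^ x = (1 - Real.exp (-t)) / t := by
  have h (x : ℝ) : Real.exp (-t) ^ x = Real.exp (-t * x) := by rw [Real.exp_mul]
  simp_rw [h]
  rw [intervalIntegral.integral_comp_mul_left (fun y => Real.exp y) (neg_ne_zero.2 ht.ne')]
  simp
  field_simp
  ring

/-- `1 / (t w) - 1 / w ^ 2 + 1 / (2 w)` with `w = 1 - exp (-t)`. -/
noncomputable def gregoryKernel (t : ℝ) : ℝ :=
  1 / (t * (1 - Real.exp (-t))) - 1 / (1 - Real.exp (-t)) ^ 2 + 1 / (2 * (1 - Real.exp (-t)))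

/-- The generating function of the shifted Gregory coefficients at `w = 1 - exp (-t)`. -/
lemma hasSum_gregoryG_one_sub_exp {t : ℝ} (ht : 0 < t) :
    HasSum (fun n : ℕ => (-1) ^ n * gregoryG (n + 2) * (1 - Real.exp (-t)) ^ n)
      (gregoryKernel t) := by
  have hlt : Real.exp (-t) < 1 := by simpa using ht
  have hw : 0 < 1 - Real.exp (-t) := by linarith
  have h := (hasSum_gregoryG_add_two hw.le (by linarith [Real.exp_pos (-t)])).div_const
    ((1 - Real.exp (-t)) ^ 2)
  rw [sub_sub_cancel, integral_exp_neg_rpow_unitInterval ht] at h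
  convert! h using 1
  · funext n
    field_simp
    ring
  · unfold gregoryKernel
    field_simp

/-- `gregoryKernel` expanded in powers of `exp (-t)`. -/
lemma hasSum_exp_expansion {t : ℝ} (ht : 0 < t) :
    HasSum (fun n : ℕ => (1 / t - ((n : ℝ) + 1 / 2)) * Real.exp (-t) ^ n) (gregoryKernel t) := by
  have hlt : Real.exp (-t) < 1 := by simpa using ht
  have hw : 1 - Real.exp (-t) ≠ 0 := by linarith
  have hnorm : ‖Real.exp (-t)‖ < 1 := by rwa [Real.norm_of_nonneg (Real.exp_pos _).le]
  have h := ((hasSum_geometric_of_norm_lt_one hnorm).mul_left (1 / t - 1 / 2)).sub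
    (hasSum_coe_mul_geometric_of_norm_lt_one hnorm)
  convert! h using 1
  · funext n
    ring
  · unfold gregoryKernel
    field_simp
    ring

/-- Integrating the expansion of `gregoryKernel` in powers of `1 - exp (-t)`. -/
lemma hasSum_gregory_integral {s v : ℂ} (hs : 0 < s.re) (hv : 0 < v.re) :
    HasSum (fun n : ℕ => (-1) ^ n * (gregoryG (n + 2) : ℂ) *
        ((∑ k ∈ Finset.range (n + 1), (-1) ^ k * (n.choose k : ℂ) * ((k : ℂ) + v) ^ (-s)) *
          Complex.Gamma s))
      (∫ t in Ioi (0 : ℝ), gammaKernel s v t * (gregoryKernel t : ℂ)) := by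
  have hbound (n : ℕ) : ∀ t ∈ Ioi (0 : ℝ),
      ‖gammaKernel s v t * ((1 - Real.exp (-t) : ℝ) : ℂ) ^ n‖ ≤ ‖gammaKernel s v t‖ := by
    intro t ht
    have hlt : Real.exp (-t) < 1 := by simpa using ht
    rw [norm_mul, norm_pow, Complex.norm_real, Real.norm_of_nonneg (by linarith)]
    exact mul_le_of_le_one_right (norm_nonneg _)
      (pow_le_one₀ (by linarith) (by linarith [Real.exp_pos (-t)]))
  have hint (n : ℕ) : IntegrableOn
      (fun t => gammaKernel s v t * ((1 - Real.exp (-t) : ℝ) : ℂ) ^ n) (Ioi 0) := by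
    refine Integrable.mono (integrableOn_gammaKernel hs hv)
      ((aestronglyMeasurable_gammaKernel s v).mul
        (Continuous.aestronglyMeasurable (by fun_prop))) ?_
    filter_upwards [ae_restrict_mem measurableSet_Ioi] with t ht using hbound n t ht
  have key := hasSum_integral_of_summable_integral_norm
    (F := fun (n : ℕ) t => (-1) ^ n * (gregoryG (n + 2) : ℂ) *
      (gammaKernel s v t * ((1 - Real.exp (-t) : ℝ) : ℂ) ^ n))
    (fun n => (hint n).const_mul _) (by
      refine Summable.of_nonneg_of_le (fun n => integral_nonneg fun _ => norm_nonneg _)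
        (fun n => ?_)
        (summable_abs_gregoryG_add_two.mul_right (∫ t in Ioi (0 : ℝ), ‖gammaKernel s v t‖))
      simp_rw [norm_mul ((-1) ^ n * (gregoryG (n + 2) : ℂ))]
      rw [MeasureTheory.integral_const_mul,
        show ‖(-1) ^ n * (gregoryG (n + 2) : ℂ)‖ = |gregoryG (n + 2)| by simp]
      exact mul_le_mul_of_nonneg_left (setIntegral_mono_on (hint n).norm
        (integrableOn_gammaKernel hs hv).norm measurableSet_Ioi (hbound n)) (abs_nonneg _))
  convert! key using 1
  · funext n
    rw [MeasureTheory.integral_const_mul, integral_gammaKernel_mul_one_sub_exp_pow hs hv]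
  · refine setIntegral_congr_fun measurableSet_Ioi fun t ht => ?_
    have h := (Complex.hasSum_ofReal.2 (hasSum_gregoryG_one_sub_exp ht)).mul_left
      (gammaKernel s v t)
    refine h.tsum_eq.symm.trans (tsum_congr fun n => ?_)
    push_cast
    ring

/-- Integrating the expansion of `gregoryKernel` in powers of `exp (-t)`. -/
lemma hasSum_hurwitz_integral {s v : ℂ} (hs : 2 < s.re) (hv : 0 < v.re) :
    HasSum (fun n : ℕ => ((n : ℂ) + v) ^ (1 - s) * Complex.Gamma (s - 1) -
        ((n : ℂ) + 1 / 2) * (((n : ℂ) + v) ^ (-s) * Complex.Gamma s))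
      (∫ t in Ioi (0 : ℝ), gammaKernel s v t * (gregoryKernel t : ℂ)) := by
  have hs0 : 0 < s.re := by linarith
  have hs1 : 0 < (s - 1).re := by simp; linarith
  have hint1 (n : ℕ) := integrableOn_gammaKernel hs1 (nat_add_re_pos hv n)
  have hint0 (n : ℕ) := integrableOn_gammaKernel hs0 (nat_add_re_pos hv n)
  have key := hasSum_integral_of_summable_integral_norm
    (F := fun (n : ℕ) t => gammaKernel (s - 1) ((n : ℂ) + v) t -
      ((n : ℂ) + 1 / 2) * gammaKernel s ((n : ℂ) + v) t)
    (fun n => (hint1 n).sub ((hint0 n).const_mul _)) (by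
      have hsum1 := (summable_nat_add_rpow_neg (σ := s.re - 1) hv (by linarith)).mul_right
        (Real.Gamma (s.re - 1))
      have hsum0 := ((summable_nat_add_rpow_neg (σ := s.re - 1) hv (by linarith)).add
        ((summable_nat_add_rpow_neg (σ := s.re) hv (by linarith)).mul_left (1 / 2 - v.re))).mul_right
        (Real.Gamma s.re)
      refine Summable.of_nonneg_of_le (fun n => integral_nonneg fun _ => norm_nonneg _)
        (fun n => ?_) (hsum1.add hsum0)
      have hpos : 0 < (n : ℝ) + v.re := by positivity
      have hc : ‖(n : ℂ) + 1 / 2‖ = (n : ℝ) + 1 / 2 := by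
        rw [show (n : ℂ) + 1 / 2 = (((n : ℝ) + 1 / 2 : ℝ) : ℂ) by push_cast; rfl,
          Complex.norm_real, Real.norm_of_nonneg (by positivity)]
      calc ∫ t in Ioi (0 : ℝ), ‖gammaKernel (s - 1) ((n : ℂ) + v) t -
              ((n : ℂ) + 1 / 2) * gammaKernel s ((n : ℂ) + v) t‖
          ≤ ∫ t in Ioi (0 : ℝ), (‖gammaKernel (s - 1) ((n : ℂ) + v) t‖ +
              ((n : ℝ) + 1 / 2) * ‖gammaKernel s ((n : ℂ) + v) t‖) := by
            refine integral_mono ((hint1 n).sub ((hint0 n).const_mul _)).norm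
              ((hint1 n).norm.add ((hint0 n).norm.const_mul _)) fun t => ?_
            refine (norm_sub_le _ _).trans_eq ?_
            rw [norm_mul, hc]
        _ = _ := by
            rw [MeasureTheory.integral_add (hint1 n).norm ((hint0 n).norm.const_mul _),
              MeasureTheory.integral_const_mul,
              integral_norm_gammaKernel hs1 (nat_add_re_pos hv n),
              integral_norm_gammaKernel hs0 (nat_add_re_pos hv n)]
            simp only [Complex.add_re, Complex.natCast_re, Complex.sub_re, Complex.one_re]
            rw [neg_sub, sub_eq_add_neg 1 s.re, Real.rpow_add hpos, Real.rpow_one]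
            ring)
  convert! key using 1
  · funext n
    rw [MeasureTheory.integral_sub (hint1 n) ((hint0 n).const_mul _),
      MeasureTheory.integral_const_mul, integral_gammaKernel hs1 (nat_add_re_pos hv n),
      integral_gammaKernel hs0 (nat_add_re_pos hv n), neg_sub]
  · refine setIntegral_congr_fun measurableSet_Ioi fun t ht => ?_
    have h := (Complex.hasSum_ofReal.2 (hasSum_exp_expansion ht)).mul_left (gammaKernel s v t)
    refine h.tsum_eq.symm.trans (tsum_congr fun n => ?_)
    rw [gammaKernel_sub_one _ _ ht, ← gammaKernel_mul_exp_pow]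
    push_cast
    ring

/-- Functional relationship for the Hurwitz zeta function with Gregory's coefficients:
for complex `s, v` with `Re s > 2` and `Re v > 0`,
`(v − 1/2) · Σ_{n=0}^∞ (n+v)^{−s} = ((s−2)/(s−1)) · Σ_{n=0}^∞ (n+v)^{1−s}
  + Σ_{n=0}^∞ (−1)^n G_{n+2} Σ_{k=0}^n (−1)^k C(n,k) (k+v)^{−s}`,
the last series being convergent. -/
theorem hurwitz_gregory_functional_relation (s v : ℂ) (hs : 2 < s.re) (hv : 0 < v.re) :
    ∃ L : ℂ,
      Tendsto (fun N : ℕ => ∑ n ∈ Finset.range N,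
          (-1) ^ n * (Complex.ofReal (gregoryG (n + 2))) *
          ∑ k ∈ Finset.range (n + 1), (-1) ^ k * (n.choose k : ℂ) * ((k : ℂ) + v) ^ (-s))
        atTop (nhds L) ∧
      (v - 1 / 2) * (∑' n : ℕ, ((n : ℂ) + v) ^ (-s)) =
        ((s - 2) / (s - 1)) * (∑' n : ℕ, ((n : ℂ) + v) ^ (1 - s)) + L := by
  have hs0 : 0 < s.re := by linarith
  have hs1 : 0 < (s - 1).re := by simp; linarith
  have hΓ : Complex.Gamma s ≠ 0 := Complex.Gamma_ne_zero_of_re_pos hs0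
  have hs1' : s - 1 ≠ 0 := fun h => by simp [h] at hs1
  have hΓs : Complex.Gamma s = (s - 1) * Complex.Gamma (s - 1) := by
    simpa using Complex.Gamma_add_one (s - 1) hs1'
  refine ⟨(∫ t in Ioi (0 : ℝ), gammaKernel s v t * (gregoryKernel t : ℂ)) / Complex.Gamma s,
    ?_, ?_⟩
  · refine (((hasSum_gregory_integral hs0 hv).div_const (Complex.Gamma s)).congr_fun
      fun n => ?_).tendsto_sum_nat
    field_simp
  · have h0 := (summable_nat_add_cpow_neg hv (z := s) (by linarith)).hasSum
    have h1 := (summable_nat_add_cpow_neg hv (z := s - 1) (by simp; linarith)).hasSum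
    simp only [neg_sub] at h1
    have h := (hasSum_hurwitz_integral hs hv).unique
      (((h1.mul_right (Complex.Gamma (s - 1))).sub
        ((h1.sub (h0.mul_left (v - 1 / 2))).mul_right (Complex.Gamma s))).congr_fun fun n => by
          have hne : (n : ℂ) + v ≠ 0 := fun h => by
            have := nat_add_re_pos hv n
            simp [h] at this
          rw [sub_eq_add_neg 1 s, Complex.cpow_add _ _ hne, Complex.cpow_one]
          ring)
    rw [h, hΓs]
    rw [hΓs] at hΓ
    have := right_ne_zero_of_mul hΓ
    field_simp
    ring
end

section
/- Let v > 1 be a real number and let Ψ(v) = Γ'(v)/Γ(v) denote the digamma function, where Γ is the real gamma function. Then the series Σ_{n=1}^∞ C_n (n−1)! / (v(v+1)(v+2)···(v+n−1)) converges and Ψ(v) = ln(v−1) + Σ_{n=1}^∞ C_n (n−1)! / (v(v+1)(v+2)···(v+n−1)), where C_n are the normalized Cauchy numbers of the second kind. In particular, ln(v−1) < Ψ(v) < ln v for all real v > 1. -/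
open Filter Finset intervalIntegral

/-- The normalized Cauchy numbers of the second kind
`C_n = ∫₀¹ x(x+1)(x+2)⋯(x+n−1)/n! dx`. -/
noncomputable def cauchyC (n : ℕ) : ℝ :=
  ∫ x in (0:ℝ)..1, (∏ i ∈ Finset.range n, (x + (i : ℝ))) / (n.factorial : ℝ)

/-- Telescoping of the quotients of rising factorials. -/
theorem sub_mul_sum_prod_div_prod {v : ℝ} (hv : 0 < v) (x : ℝ) (N : ℕ) :
    (v - x) * ∑ n ∈ range N, (∏ i ∈ range n, (x + (i : ℝ))) / ∏ i ∈ range (n + 1), (v + (i : ℝ)) =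
      1 - (∏ i ∈ range N, (x + (i : ℝ))) / ∏ i ∈ range N, (v + (i : ℝ)) := by
  induction N with
  | zero => simp
  | succ N ih =>
    have h1 : (∏ i ∈ range N, (v + (i : ℝ))) ≠ 0 :=
      (prod_pos fun i _ => by positivity).ne'
    have h2 : v + (N : ℝ) ≠ 0 := by positivity
    rw [sum_range_succ, mul_add, ih, prod_range_succ, prod_range_succ]
    field_simp
    ring

theorem prod_range_one_add_eq_factorial (n : ℕ) :
    ∏ i ∈ range n, ((1 : ℝ) + (i : ℝ)) = (n.factorial : ℝ) := by
  rw [← prod_range_add_one_eq_factorial]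
  push_cast
  exact prod_congr rfl fun i _ => add_comm _ _

theorem cauchyC_mul_factorial (n : ℕ) :
    cauchyC n * (n.factorial : ℝ) = ∫ x in (0:ℝ)..1, ∏ i ∈ range n, (x + (i : ℝ)) := by
  have h : (n.factorial : ℝ) ≠ 0 := by positivity
  rw [cauchyC, intervalIntegral.integral_div, div_mul_cancel₀ _ h]

theorem cauchyC_nonneg (n : ℕ) : 0 ≤ cauchyC n :=
  intervalIntegral.integral_nonneg zero_le_one fun _ hx =>
    div_nonneg (prod_nonneg fun i _ => add_nonneg hx.1 i.cast_nonneg) (Nat.cast_nonneg _)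

theorem prod_range_add_le_factorial {x : ℝ} (h0 : 0 ≤ x) (h1 : x ≤ 1) (n : ℕ) :
    ∏ i ∈ range n, (x + (i : ℝ)) ≤ (n.factorial : ℝ) := by
  rw [← prod_range_one_add_eq_factorial]
  gcongr

theorem cauchyC_le_one (n : ℕ) : cauchyC n ≤ 1 := by
  have h : (∫ x in (0:ℝ)..1, ∏ i ∈ range n, (x + (i : ℝ))) ≤
      ∫ _ in (0:ℝ)..1, (n.factorial : ℝ) := by
    refine intervalIntegral.integral_mono_on zero_le_one
      (Continuous.intervalIntegrable (by fun_prop) _ _) (by simp) fun x hx => ?_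
    exact prod_range_add_le_factorial hx.1 hx.2 n
  rw [← cauchyC_mul_factorial] at h
  have hn : (0 : ℝ) < n.factorial := by positivity
  simp only [intervalIntegral.integral_const, sub_zero, one_smul] at h
  exact le_of_mul_le_mul_right (by simpa using h) hn

theorem cauchyC_one : cauchyC 1 = 1 / 2 := by
  simp [cauchyC]

/-- The general term of the expansion of `Ψ(v)`. -/
noncomputable def cauchyTerm (v : ℝ) (n : ℕ) : ℝ :=
  cauchyC (n + 1) * (n.factorial : ℝ) / ∏ i ∈ range (n + 1), (v + (i : ℝ))

theorem cauchyTerm_nonneg {v : ℝ} (hv : 0 < v) (n : ℕ) : 0 ≤ cauchyTerm v n :=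
  div_nonneg (mul_nonneg (cauchyC_nonneg _) (Nat.cast_nonneg _))
    (prod_nonneg fun i _ => by positivity)

theorem cauchyTerm_zero (v : ℝ) : cauchyTerm v 0 = 1 / (2 * v) := by
  simp [cauchyTerm, cauchyC_one]
  ring

theorem cauchyTerm_le {v : ℝ} (hv : 0 < v) (n : ℕ) :
    cauchyTerm v n ≤ (n.factorial : ℝ) / ∏ i ∈ range (n + 1), (v + (i : ℝ)) := by
  have h : 0 < ∏ i ∈ range (n + 1), (v + (i : ℝ)) := prod_pos fun i _ => by positivity
  unfold cauchyTerm
  gcongr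
  exact mul_le_of_le_one_left (Nat.cast_nonneg _) (cauchyC_le_one _)

theorem sum_factorial_div_prod_le {v : ℝ} (hv : 1 < v) (N : ℕ) :
    ∑ n ∈ range N, (n.factorial : ℝ) / ∏ i ∈ range (n + 1), (v + (i : ℝ)) ≤ 1 / (v - 1) := by
  have h := sub_mul_sum_prod_div_prod (zero_lt_one.trans hv) 1 N
  simp only [prod_range_one_add_eq_factorial] at h
  rw [le_div_iff₀' (by linarith), h, sub_le_self_iff]
  exact div_nonneg (Nat.cast_nonneg _) (prod_nonneg fun i _ => by positivity)

theorem sum_cauchyTerm_le {v : ℝ} (hv : 1 < v) (N : ℕ) :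
    ∑ n ∈ range (N + 1), cauchyTerm v n ≤ 1 / (v - 1) - 1 / (2 * v) := by
  have hv0 : 0 < v := zero_lt_one.trans hv
  have h := sum_factorial_div_prod_le hv (N + 1)
  rw [sum_range_succ'] at h ⊢
  have h2 : ∑ n ∈ range N, cauchyTerm v (n + 1) ≤ _ :=
    sum_le_sum fun n _ => cauchyTerm_le hv0 (n + 1)
  rw [cauchyTerm_zero]
  have h3 : 1 / (2 * v) + 1 / (2 * v) = 1 / v := by field_simp; norm_num
  simp at h h2 h3 ⊢
  linarith

theorem summable_cauchyTerm {v : ℝ} (hv : 1 < v) : Summable (cauchyTerm v) := by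
  have hv0 : 0 < v := zero_lt_one.trans hv
  refine summable_of_sum_range_le (c := 1 / (v - 1)) (cauchyTerm_nonneg hv0) fun N => ?_
  exact (sum_le_sum fun n _ => cauchyTerm_le hv0 n).trans (sum_factorial_div_prod_le hv N)

theorem tsum_cauchyTerm_lt {v : ℝ} (hv : 1 < v) : ∑' n, cauchyTerm v n < 1 / (v - 1) := by
  have hv0 : 0 < v := zero_lt_one.trans hv
  have h := le_of_tendsto' ((tendsto_add_atTop_iff_nat 1).2
    (summable_cauchyTerm hv).hasSum.tendsto_sum_nat) (sum_cauchyTerm_le hv)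
  have : 0 < 1 / (2 * v) := by positivity
  linarith

theorem tsum_cauchyTerm_pos {v : ℝ} (hv : 1 < v) : 0 < ∑' n, cauchyTerm v n := by
  have hv0 : 0 < v := zero_lt_one.trans hv
  refine (summable_cauchyTerm hv).tsum_pos (cauchyTerm_nonneg hv0) 0 ?_
  rw [cauchyTerm_zero]
  positivity

theorem tendsto_factorial_div_prod {v : ℝ} (hv : 1 < v) :
    Tendsto (fun N : ℕ => (N.factorial : ℝ) / ∏ i ∈ range N, (v + (i : ℝ))) atTop (nhds 0) := by
  have key : ∀ N : ℕ, 1 + (v - 1) * ∑ i ∈ range N, 1 / ((i : ℝ) + 1) ≤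
      (∏ i ∈ range N, (v + (i : ℝ))) / (N.factorial : ℝ) := by
    intro N
    induction N with
    | zero => simp
    | succ N ih =>
      have h1 : 1 ≤ (∏ i ∈ range N, (v + (i : ℝ))) / (N.factorial : ℝ) := by
        refine le_trans ?_ ih
        have : 0 ≤ ∑ i ∈ range N, 1 / ((i : ℝ) + 1) := sum_nonneg fun i _ => by positivity
        nlinarith
      have h2 : (∏ i ∈ range (N + 1), (v + (i : ℝ))) / ((N + 1).factorial : ℝ) =
          (∏ i ∈ range N, (v + (i : ℝ))) / (N.factorial : ℝ) *
            (1 + (v - 1) * (1 / ((N : ℝ) + 1))) := by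
        rw [prod_range_succ, Nat.factorial_succ]
        push_cast
        field_simp
        ring
      have h3 : 0 ≤ (v - 1) * (1 / ((N : ℝ) + 1)) := mul_nonneg (by linarith) (by positivity)
      rw [h2, sum_range_succ]
      nlinarith
  have h := tendsto_atTop_mono key (tendsto_atTop_add_const_left _ _
    (Real.tendsto_sum_range_one_div_nat_succ_atTop.const_mul_atTop (sub_pos.2 hv)))
  refine h.inv_tendsto_atTop.congr fun N => ?_
  rw [Pi.inv_apply, inv_div]

theorem cauchyTerm_sub {v : ℝ} (hv : 0 < v) (n : ℕ) :
    cauchyTerm v n - cauchyTerm (v + 1) n =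
      ∫ x in (0:ℝ)..1, (∏ i ∈ range (n + 1), (x + (i : ℝ))) / ∏ i ∈ range (n + 2), (v + (i : ℝ)) := by
  have h1 : ∏ i ∈ range (n + 1), (v + 1 + (i : ℝ)) =
      (∏ i ∈ range (n + 2), (v + (i : ℝ))) / v := by
    rw [prod_range_succ' _ (n + 1)]
    simp only [Nat.cast_zero, add_zero]
    rw [mul_div_cancel_right₀ _ hv.ne']
    refine prod_congr rfl fun i _ => ?_
    push_cast
    ring
  have h2 : (∏ i ∈ range (n + 1), (v + (i : ℝ))) ≠ 0 :=
    (prod_pos fun i _ => by positivity).ne'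
  have h3 : v + ((n + 1 : ℕ) : ℝ) ≠ 0 := by positivity
  rw [intervalIntegral.integral_div, ← cauchyC_mul_factorial, cauchyTerm, cauchyTerm, h1,
    prod_range_succ _ (n + 1), Nat.factorial_succ]
  push_cast at h3 ⊢
  field_simp
  ring

theorem sum_cauchyTerm_sub {v : ℝ} (hv : 1 < v) (N : ℕ) :
    ∑ n ∈ range N, (cauchyTerm v n - cauchyTerm (v + 1) n) =
      Real.log v - Real.log (v - 1) - 1 / v - ∫ x in (0:ℝ)..1,
        (∏ i ∈ range (N + 1), (x + (i : ℝ))) / (∏ i ∈ range (N + 1), (v + (i : ℝ))) / (v - x) := by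
  have hv0 : 0 < v := zero_lt_one.trans hv
  have hne : ∀ x ∈ Set.uIcc (0 : ℝ) 1, v - x ≠ 0 := fun x hx => by
    rw [Set.uIcc_of_le zero_le_one] at hx
    linarith [hx.2]
  have hlog : ∫ x in (0:ℝ)..1, 1 / (v - x) = Real.log v - Real.log (v - 1) := by
    rw [intervalIntegral.integral_comp_sub_left (fun y => 1 / y) v,
      integral_one_div_of_pos (by linarith) (by linarith), sub_zero,
      Real.log_div hv0.ne' (by linarith)]
  have hint : IntervalIntegrable (fun x : ℝ => 1 / (v - x)) MeasureTheory.volume 0 1 :=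
    ContinuousOn.intervalIntegrable (ContinuousOn.div (by fun_prop) (by fun_prop) hne)
  have hint' : IntervalIntegrable (fun x : ℝ => (∏ i ∈ range (N + 1), (x + (i : ℝ))) /
      (∏ i ∈ range (N + 1), (v + (i : ℝ))) / (v - x)) MeasureTheory.volume 0 1 :=
    ContinuousOn.intervalIntegrable (ContinuousOn.div (by fun_prop) (by fun_prop) hne)
  have hconst : ∫ _ in (0:ℝ)..1, 1 / v = 1 / v := by simp
  rw [sum_congr rfl fun n _ => cauchyTerm_sub hv0 n, ← intervalIntegral.integral_finsetSum
    fun n _ => Continuous.intervalIntegrable (by fun_prop) _ _, ← hlog]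
  nth_rw 1 [← hconst]
  rw [← intervalIntegral.integral_sub hint (by simp),
    ← intervalIntegral.integral_sub (hint.sub (by simp)) hint']
  refine intervalIntegral.integral_congr fun x hx => ?_
  have h := sub_mul_sum_prod_div_prod hv0 x (N + 1)
  rw [sum_range_succ'] at h
  have hx := hne x hx
  simp only [range_zero, prod_empty, zero_add, range_one, prod_singleton, Nat.cast_zero,
    add_zero] at h
  have h2 := eq_div_of_mul_eq hx ((mul_comm _ _).trans h)
  rw [sub_div] at h2
  linarith

theorem tsum_cauchyTerm_sub {v : ℝ} (hv : 1 < v) :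
    ∑' n, cauchyTerm v n - ∑' n, cauchyTerm (v + 1) n =
      Real.log v - Real.log (v - 1) - 1 / v := by
  have hv0 : 0 < v := zero_lt_one.trans hv
  have hs := ((summable_cauchyTerm hv).hasSum.sub
    (summable_cauchyTerm (by linarith : 1 < v + 1)).hasSum).tendsto_sum_nat
  refine tendsto_nhds_unique hs ?_
  simp only [sum_cauchyTerm_sub hv]
  have hlim : Tendsto (fun N : ℕ => ((N + 1).factorial : ℝ) /
      (∏ i ∈ range (N + 1), (v + (i : ℝ))) / (v - 1)) atTop (nhds 0) := by
    simpa using ((tendsto_add_atTop_iff_nat 1).2 (tendsto_factorial_div_prod hv)).div_const (v - 1)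
  have hpos : ∀ N : ℕ, 0 < ∏ i ∈ range (N + 1), (v + (i : ℝ)) := fun N =>
    prod_pos fun i _ => by positivity
  have h0 := squeeze_zero (f := fun N : ℕ => ∫ x in (0:ℝ)..1,
      (∏ i ∈ range (N + 1), (x + (i : ℝ))) / (∏ i ∈ range (N + 1), (v + (i : ℝ))) / (v - x))
      (fun N => ?_) (fun N => ?_) hlim
  · simpa using h0.const_sub (Real.log v - Real.log (v - 1) - 1 / v)
  · refine intervalIntegral.integral_nonneg zero_le_one fun x hx => ?_
    refine div_nonneg (div_nonneg (prod_nonneg fun i _ => ?_) (hpos N).le) (by linarith [hx.2])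
    exact add_nonneg hx.1 i.cast_nonneg
  · have hc : ∫ _ in (0:ℝ)..1, ((N + 1).factorial : ℝ) /
        (∏ i ∈ range (N + 1), (v + (i : ℝ))) / (v - 1) = ((N + 1).factorial : ℝ) /
        (∏ i ∈ range (N + 1), (v + (i : ℝ))) / (v - 1) := by simp
    rw [← hc]
    refine intervalIntegral.integral_mono_on zero_le_one
      (ContinuousOn.intervalIntegrable (ContinuousOn.div (by fun_prop) (by fun_prop) ?_))
      (by simp) fun x hx => ?_
    · intro x hx
      rw [Set.uIcc_of_le zero_le_one] at hx
      linarith [hx.2]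
    · have := hpos N
      have h1 : (0 : ℝ) < v - 1 := by linarith
      have := prod_range_add_le_factorial hx.1 hx.2 (N + 1)
      have := hx.2
      gcongr

theorem differentiableAt_Gamma_of_pos {v : ℝ} (hv : 0 < v) : DifferentiableAt ℝ Real.Gamma v :=
  Real.differentiableAt_Gamma fun m => by
    have : (0 : ℝ) ≤ m := m.cast_nonneg
    linarith

theorem hasDerivAt_log_Gamma {v : ℝ} (hv : 0 < v) :
    HasDerivAt (Real.log ∘ Real.Gamma) (deriv Real.Gamma v / Real.Gamma v) v :=
  (differentiableAt_Gamma_of_pos hv).hasDerivAt.log (Real.Gamma_pos_of_pos hv).ne'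

theorem log_Gamma_add_one {v : ℝ} (hv : 0 < v) :
    Real.log (Real.Gamma (v + 1)) = Real.log v + Real.log (Real.Gamma v) := by
  rw [Real.Gamma_add_one hv.ne', Real.log_mul hv.ne' (Real.Gamma_pos_of_pos hv).ne']

theorem deriv_Gamma_div_Gamma_add_one {v : ℝ} (hv : 0 < v) :
    deriv Real.Gamma (v + 1) / Real.Gamma (v + 1) =
      deriv Real.Gamma v / Real.Gamma v + 1 / v := by
  have h1 := (hasDerivAt_log_Gamma (by linarith : 0 < v + 1)).comp_add_const v 1
  have h2 := (Real.hasDerivAt_log hv.ne').add (hasDerivAt_log_Gamma hv)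
  have h3 := h1.congr_of_eventuallyEq (f₁ := Real.log + Real.log ∘ Real.Gamma) (by
    filter_upwards [lt_mem_nhds hv] with x hx
    exact (log_Gamma_add_one hx).symm)
  rw [h3.unique h2]
  ring

theorem deriv_Gamma_div_Gamma_le_log {v : ℝ} (hv : 0 < v) :
    deriv Real.Gamma v / Real.Gamma v ≤ Real.log v := by
  have h := Real.convexOn_log_Gamma.le_slope_of_hasDerivAt (Set.mem_Ioi.2 hv)
    (Set.mem_Ioi.2 (by linarith : 0 < v + 1)) (by linarith) (hasDerivAt_log_Gamma hv)
  simpa [slope_def_field, log_Gamma_add_one hv] using h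

theorem log_sub_one_le_deriv_Gamma_div_Gamma {v : ℝ} (hv : 1 < v) :
    Real.log (v - 1) ≤ deriv Real.Gamma v / Real.Gamma v := by
  have hv1 : 0 < v - 1 := sub_pos.2 hv
  have h := Real.convexOn_log_Gamma.slope_le_of_hasDerivAt (Set.mem_Ioi.2 hv1)
    (Set.mem_Ioi.2 (by linarith : 0 < v)) (by linarith) (hasDerivAt_log_Gamma (by linarith))
  have h2 := log_Gamma_add_one hv1
  rw [sub_add_cancel] at h2
  simpa [slope_def_field, h2] using h

theorem deriv_Gamma_div_Gamma_eq {v : ℝ} (hv : 1 < v) :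
    deriv Real.Gamma v / Real.Gamma v = Real.log (v - 1) + ∑' n, cauchyTerm v n := by
  set D : ℝ → ℝ := fun w => deriv Real.Gamma w / Real.Gamma w - Real.log (w - 1) -
    ∑' n, cauchyTerm w n with hD
  have hstep : ∀ w, 1 < w → D (w + 1) = D w := fun w hw => by
    have h1 := deriv_Gamma_div_Gamma_add_one (zero_lt_one.trans hw)
    have h2 := tsum_cauchyTerm_sub hw
    simp only [hD, add_sub_cancel_right]
    linarith
  have hper : ∀ n : ℕ, D (v + n) = D v := fun n => by
    induction n with
    | zero => simp
    | succ n ih =>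
      have : 1 < v + n := by linarith [n.cast_nonneg (α := ℝ)]
      rw [Nat.cast_succ, ← add_assoc, hstep _ this, ih]
  have hbound : ∀ w, 1 < w → |D w| ≤ 1 / (w - 1) := fun w hw => by
    have hw1 : 0 < w - 1 := sub_pos.2 hw
    have h1 := deriv_Gamma_div_Gamma_le_log (zero_lt_one.trans hw)
    have h2 := log_sub_one_le_deriv_Gamma_div_Gamma hw
    have h3 := tsum_cauchyTerm_lt hw
    have h4 := tsum_cauchyTerm_pos hw
    have h5 := Real.log_le_sub_one_of_pos (div_pos (zero_lt_one.trans hw) hw1)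
    rw [Real.log_div (by linarith) hw1.ne'] at h5
    have h6 : w / (w - 1) - 1 = 1 / (w - 1) := by field_simp; ring
    rw [abs_le]
    constructor <;> simp only [hD] <;> linarith
  have hlim : Tendsto (fun n : ℕ => 1 / (v + n - 1)) atTop (nhds 0) := by
    have h := tendsto_atTop_add_const_left atTop (v - 1) (tendsto_natCast_atTop_atTop (R := ℝ))
    refine h.inv_tendsto_atTop.congr fun n => ?_
    rw [Pi.inv_apply, one_div, add_sub_right_comm]
  have h0 : |D v| ≤ 0 := ge_of_tendsto' hlim fun n => by
    rw [← hper n]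
    exact hbound _ (by linarith [n.cast_nonneg (α := ℝ)])
  have := abs_nonpos_iff.1 h0
  simp only [hD] at this
  linarith

/-- Binet–Nørlund expansion of the digamma function with the normalized Cauchy numbers of
the second kind: for real `v > 1`, the series `Σ_{n=1}^∞ C_n (n−1)!/(v(v+1)⋯(v+n−1))`
converges, `Ψ(v) = ln(v−1) + Σ_{n=1}^∞ C_n (n−1)!/(v(v+1)⋯(v+n−1))`, where `Ψ = Γ'/Γ`,
and consequently `ln(v−1) < Ψ(v) < ln v`. -/
theorem digamma_cauchy_series (v : ℝ) (hv : 1 < v) :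
    (∃ L : ℝ,
      Tendsto (fun N : ℕ => ∑ n ∈ Finset.range N,
          cauchyC (n + 1) * (n.factorial : ℝ) / (∏ i ∈ Finset.range (n + 1), (v + (i : ℝ))))
        atTop (nhds L) ∧
      deriv Real.Gamma v / Real.Gamma v = Real.log (v - 1) + L) ∧
    Real.log (v - 1) < deriv Real.Gamma v / Real.Gamma v ∧
    deriv Real.Gamma v / Real.Gamma v < Real.log v := by
  refine ⟨⟨∑' n, cauchyTerm v n, (summable_cauchyTerm hv).hasSum.tendsto_sum_nat,
    deriv_Gamma_div_Gamma_eq hv⟩, ?_, ?_⟩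
  · linarith [deriv_Gamma_div_Gamma_eq hv, tsum_cauchyTerm_pos hv]
  · have hv' : 1 < v + 1 := by linarith
    have h1 := deriv_Gamma_div_Gamma_eq hv'
    have h2 := tsum_cauchyTerm_lt hv'
    have h3 := deriv_Gamma_div_Gamma_add_one (zero_lt_one.trans hv)
    rw [add_sub_cancel_right] at h1 h2
    linarith
end

section
/- Let m ≥ 1 be an integer and let a > −1 be a real number. Then the Euler–Mascheroni constant γ satisfies γ = −(1/m) Σ_{l=1}^{m} ln(a+l) − (1/m) Σ_{n=1}^∞ (−1)^n N_{n,m}(a)/n, the infinite series being convergent. (For m = 1, a = 0 this reduces to the Fontana–Mascheroni series γ = Σ_{n=1}^∞ |G_n|/n.) -/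
open Filter Finset intervalIntegral

/-- The signed generalized binomial coefficient `(-1)^n * x(x-1)⋯(x-n+1)/n!`. -/
noncomputable def signedBinom (n : ℕ) (x : ℝ) : ℝ :=
  (-1) ^ n * ((∏ i ∈ Finset.range n, (x - (i : ℝ))) / (n.factorial : ℝ))

/-- The value `j! k! / (j + k + 1)!` of the Beta function at `(j + 1, k + 1)`. -/
noncomputable def natBeta (j k : ℕ) : ℝ :=
  (j.factorial : ℝ) * k.factorial / (j + k + 1).factorial

lemma signedBinom_succ (n : ℕ) (x : ℝ) :
    signedBinom (n + 1) x = signedBinom n x * ((n - x) / (n + 1)) := by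
  have h1 : (n.factorial : ℝ) ≠ 0 := by positivity
  have h2 : (n : ℝ) + 1 ≠ 0 := by positivity
  simp only [signedBinom, Finset.prod_range_succ, Nat.factorial_succ, pow_succ]
  push_cast
  field_simp
  ring

lemma continuous_signedBinom (n : ℕ) : Continuous (signedBinom n) := by
  unfold signedBinom
  fun_prop

lemma integral_signedBinom (n m : ℕ) (a : ℝ) :
    ∫ x in a..(a + (m : ℝ)), signedBinom n x = (-1) ^ n * serN n m a := by
  simp only [signedBinom, serN, intervalIntegral.integral_const_mul]

lemma natBeta_nonneg (j k : ℕ) : 0 ≤ natBeta j k := by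
  unfold natBeta
  positivity

lemma natBeta_succ_left (j k : ℕ) :
    natBeta (j + 1) k = natBeta j k * ((j + 1) / (j + k + 2)) := by
  have e : j + 1 + k + 1 = (j + k + 1) + 1 := by ring
  have h1 : ((j + k + 1).factorial : ℝ) ≠ 0 := by positivity
  have h2 : (j : ℝ) + k + 2 ≠ 0 := by positivity
  have h3 : (j : ℝ) + k + 1 + 1 ≠ 0 := by positivity
  simp only [natBeta, e, Nat.factorial_succ (j + k + 1), Nat.factorial_succ j]
  push_cast
  field_simp
  ring

lemma natBeta_succ_right (j k : ℕ) :
    natBeta j (k + 1) = natBeta j k * ((k + 1) / (j + k + 2)) := by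
  have h1 : ((j + k + 1).factorial : ℝ) ≠ 0 := by positivity
  have h2 : (j : ℝ) + k + 2 ≠ 0 := by positivity
  have h3 : (j : ℝ) + k + 1 + 1 ≠ 0 := by positivity
  simp only [natBeta, ← add_assoc, Nat.factorial_succ (j + k + 1), Nat.factorial_succ k]
  push_cast
  field_simp
  ring

lemma natBeta_sub (j k : ℕ) : natBeta j k - natBeta j (k + 1) = natBeta (j + 1) k := by
  have h2 : (j : ℝ) + k + 2 ≠ 0 := by positivity
  rw [natBeta_succ_left, natBeta_succ_right]
  field_simp
  ring

lemma natBeta_zero_left (k : ℕ) : natBeta 0 k = 1 / (k + 1) := by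
  have h1 : (k.factorial : ℝ) ≠ 0 := by positivity
  simp only [natBeta, zero_add, Nat.factorial_succ, Nat.factorial_zero]
  push_cast
  field_simp

lemma natBeta_zero_right (j : ℕ) : natBeta j 0 = 1 / (j + 1) := by
  have h1 : (j.factorial : ℝ) ≠ 0 := by positivity
  simp only [natBeta, add_zero, Nat.factorial_succ, Nat.factorial_zero]
  push_cast
  field_simp

lemma natBeta_le (j k : ℕ) : natBeta j k ≤ 1 / (j + 1) * (1 / (k + 1)) := by
  induction j with
  | zero => simp [natBeta_zero_left]
  | succ j ih =>
    rw [natBeta_succ_left]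
    have : ((j : ℝ) + 1) / (j + k + 2) ≤ (j + 1) / (j + 2) := by
      gcongr
      linarith [(Nat.cast_nonneg k : (0 : ℝ) ≤ k)]
    calc natBeta j k * ((j + 1) / (j + k + 2))
        ≤ 1 / (j + 1) * (1 / (k + 1)) * ((j + 1) / (j + 2)) := by gcongr
      _ = 1 / (((j + 1 : ℕ) : ℝ) + 1) * (1 / (k + 1)) := by
        push_cast
        field_simp
        ring

lemma natBeta_le_one_div (j k : ℕ) : natBeta j k ≤ 1 / (j + 1) := by
  refine (natBeta_le j k).trans (mul_le_of_le_one_right (by positivity) ?_)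
  rw [div_le_one (by positivity)]
  linarith [(Nat.cast_nonneg k : (0 : ℝ) ≤ k)]

lemma natBeta_mul_le_one (j k : ℕ) : natBeta j k * (j + k + 1) ≤ 1 := by
  have h : (j.factorial : ℝ) * k.factorial ≤ (j + k).factorial := by
    exact_mod_cast Nat.le_of_dvd (Nat.factorial_pos _)
      (Nat.factorial_mul_factorial_dvd_factorial_add j k)
  have h1 : 0 < ((j + k).factorial : ℝ) := by positivity
  rw [natBeta, Nat.factorial_succ, div_mul_eq_mul_div, div_le_one (by positivity)]
  push_cast
  nlinarith [(Nat.cast_nonneg k : (0 : ℝ) ≤ k), (Nat.cast_nonneg j : (0 : ℝ) ≤ j)]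

lemma sum_signedBinom_mul_natBeta {x : ℝ} (hx : -1 < x) (k J : ℕ) :
    ∑ j ∈ Finset.range J, signedBinom (j + 1) x * natBeta (j + 1) k =
      (1 - signedBinom (J + 1) x * (natBeta (J + 1) k * (J + k + 2))) / (k + 1 + x)
        - 1 / (k + 1) := by
  have hk : (0 : ℝ) ≤ k := Nat.cast_nonneg k
  have h0 : (k : ℝ) + 1 + x ≠ 0 := by linarith
  induction J with
  | zero =>
    have h2 : (k : ℝ) + 2 ≠ 0 := by positivity
    simp [signedBinom, natBeta_succ_left 0 k, natBeta_zero_left]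
    field_simp
    ring
  | succ J ih =>
    have h2 : (J : ℝ) + 1 + k + 2 ≠ 0 := by positivity
    have h3 : (J : ℝ) + 1 + 1 ≠ 0 := by positivity
    rw [Finset.sum_range_succ, ih, signedBinom_succ (J + 1), natBeta_succ_left (J + 1)]
    push_cast
    field_simp
    ring

lemma abs_signedBinom_mul_rpow_succ_le {n : ℕ} {x δ : ℝ} (hδ : 0 < δ) (hδ1 : δ ≤ 1)
    (hx : δ ≤ x + 1) (hn : x ≤ n) :
    |signedBinom (n + 1) x| * ((n : ℝ) + 2) ^ δ ≤ |signedBinom n x| * ((n : ℝ) + 1) ^ δ := by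
  have hp : (0 : ℝ) < (n : ℝ) + 1 := by positivity
  have hb : ((n : ℝ) + 2) ^ δ ≤ ((n : ℝ) + 1) ^ δ * (1 + δ / (n + 1)) := by
    have e : (n : ℝ) + 2 = (n + 1) * (1 + 1 / (n + 1)) := by field_simp; ring
    rw [e, Real.mul_rpow hp.le (by positivity)]
    gcongr
    have := rpow_one_add_le_one_add_mul_self (s := 1 / ((n : ℝ) + 1))
      (by have : 0 ≤ 1 / ((n : ℝ) + 1) := by positivity
          linarith) hδ.le hδ1
    calc _ ≤ _ := this
      _ = _ := by ring
  have hr : ((n : ℝ) - x) / (n + 1) ≤ 1 - δ / (n + 1) := by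
    rw [div_le_iff₀ hp, sub_mul, div_mul_cancel₀ _ hp.ne']
    linarith
  have hr0 : 0 ≤ ((n : ℝ) - x) / (n + 1) := div_nonneg (by linarith) hp.le
  rw [signedBinom_succ, abs_mul, abs_of_nonneg hr0, mul_assoc]
  gcongr
  calc ((n : ℝ) - x) / (n + 1) * ((n : ℝ) + 2) ^ δ
      ≤ (1 - δ / (n + 1)) * (((n : ℝ) + 1) ^ δ * (1 + δ / (n + 1))) := by
        have : 0 ≤ 1 - δ / ((n : ℝ) + 1) := hr0.trans hr
        gcongr
    _ = ((n : ℝ) + 1) ^ δ * (1 - (δ / (n + 1)) ^ 2) := by ring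
    _ ≤ ((n : ℝ) + 1) ^ δ := by
        refine mul_le_of_le_one_right (by positivity) ?_
        linarith [sq_nonneg (δ / ((n : ℝ) + 1))]

/-- Uniform decay of the binomial coefficients on compact subintervals of `(-1, ∞)`. -/
lemma exists_abs_signedBinom_le {a : ℝ} (ha : -1 < a) (b : ℝ) :
    ∃ δ : ℝ, 0 < δ ∧ ∃ M : ℝ, 0 ≤ M ∧ ∀ x, a ≤ x → x ≤ b → ∀ n : ℕ,
      |signedBinom n x| ≤ M * ((n : ℝ) + 1) ^ (-δ) := by
  obtain ⟨p, hp⟩ := exists_nat_ge b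
  set δ := min (a + 1) 1 with hδ
  have hδ0 : 0 < δ := lt_min (by linarith) one_pos
  set X := |a| + |b| + 1
  have hX1 : 1 ≤ X := by linarith [abs_nonneg a, abs_nonneg b]
  refine ⟨δ, hδ0, X ^ p * ((p : ℝ) + 1) ^ δ, by positivity, fun x hax hxb n => ?_⟩
  have hsmall : ∀ n, |signedBinom n x| ≤ X ^ n := by
    intro n
    induction n with
    | zero => simp [signedBinom]
    | succ n ih =>
      rw [signedBinom_succ, abs_mul, pow_succ]
      gcongr
      have hn : (0 : ℝ) ≤ n := Nat.cast_nonneg n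
      rw [abs_div, abs_of_pos (by positivity : (0 : ℝ) < (n : ℝ) + 1),
        div_le_iff₀ (by positivity)]
      have hxX : |x| ≤ X - 1 := by
        rw [abs_le]
        constructor
        · linarith [neg_abs_le a, abs_nonneg b]
        · linarith [le_abs_self b, abs_nonneg a]
      calc |(n : ℝ) - x| ≤ |(n : ℝ)| + |x| := abs_sub _ _
        _ ≤ n + (X - 1) := by rw [abs_of_nonneg hn]; linarith
        _ ≤ X * (n + 1) := by nlinarith
  have key : |signedBinom n x| * ((n : ℝ) + 1) ^ δ ≤ X ^ p * ((p : ℝ) + 1) ^ δ := by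
    rcases le_total n p with h | h
    · gcongr
      exact (hsmall n).trans (pow_le_pow_right₀ hX1 h)
    · induction n, h using Nat.le_induction with
      | base => gcongr; exact hsmall p
      | succ n hn ih =>
        refine le_trans ?_ ih
        have hxn : x ≤ n := (hxb.trans hp).trans (by exact_mod_cast hn)
        have := abs_signedBinom_mul_rpow_succ_le hδ0 (min_le_right _ _)
          ((min_le_left _ _).trans (by linarith : a + 1 ≤ x + 1)) hxn
        push_cast
        rwa [add_assoc, one_add_one_eq_two]
  rw [Real.rpow_neg (by positivity), ← div_eq_mul_inv, le_div_iff₀ (by positivity)]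
  exact key

lemma summable_rpow_neg_mul_one_div {δ : ℝ} (hδ : 0 < δ) (M : ℝ) :
    Summable fun j : ℕ => M * ((j : ℝ) + 1) ^ (-δ) * (1 / ((j : ℝ) + 1)) := by
  have h := (summable_nat_add_iff 1).2
    (Real.summable_nat_rpow.2 (by linarith : -δ + -1 < -1))
  refine (h.mul_left M).congr fun j => ?_
  push_cast
  rw [Real.rpow_add (by positivity), Real.rpow_neg_one]
  ring

lemma abs_signedBinom_succ_mul_le {δ M x w : ℝ} (hδ : 0 < δ) (hM : 0 ≤ M) {j : ℕ}
    (h : ∀ n : ℕ, |signedBinom n x| ≤ M * ((n : ℝ) + 1) ^ (-δ))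
    (hw : |w| ≤ 1 / ((j : ℝ) + 1)) :
    |signedBinom (j + 1) x * w| ≤ M * ((j : ℝ) + 1) ^ (-δ) * (1 / ((j : ℝ) + 1)) := by
  rw [abs_mul]
  have h1 : |signedBinom (j + 1) x| ≤ M * ((j : ℝ) + 1) ^ (-δ) := by
    refine (h (j + 1)).trans ?_
    push_cast
    gcongr M * ?_
    exact Real.rpow_le_rpow_of_nonpos (by positivity) (by linarith) (by linarith)
  gcongr

lemma abs_natBeta_succ_le (j k : ℕ) : |natBeta (j + 1) k| ≤ 1 / ((j : ℝ) + 1) := by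
  rw [abs_of_nonneg (natBeta_nonneg _ _), ← natBeta_sub]
  linarith [natBeta_le_one_div j k, natBeta_nonneg j (k + 1)]

lemma hasSum_signedBinom_mul_natBeta {x : ℝ} (hx : -1 < x) (k : ℕ) :
    HasSum (fun j => signedBinom (j + 1) x * natBeta (j + 1) k)
      (1 / (k + 1 + x) - 1 / (k + 1)) := by
  obtain ⟨δ, hδ, M, hM, h⟩ := exists_abs_signedBinom_le hx x
  have hx' := h x le_rfl le_rfl
  have hs : Summable fun j => signedBinom (j + 1) x * natBeta (j + 1) k :=
    (summable_rpow_neg_mul_one_div hδ M).of_norm_bounded fun j =>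
      abs_signedBinom_succ_mul_le hδ hM hx' (abs_natBeta_succ_le j k)
  rw [hs.hasSum_iff_tendsto_nat]
  simp only [sum_signedBinom_mul_natBeta hx]
  have hz : Tendsto (fun n : ℕ => M * ((n : ℝ) + 1) ^ (-δ)) atTop (nhds 0) := by
    have := ((tendsto_rpow_neg_atTop hδ).comp
      (tendsto_natCast_atTop_atTop.atTop_add (tendsto_const_nhds (x := (1 : ℝ))))).const_mul M
    simpa using this
  have hz' : Tendsto (fun J : ℕ =>
      signedBinom (J + 1) x * (natBeta (J + 1) k * ((J : ℝ) + k + 2))) atTop (nhds 0) := by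
    refine squeeze_zero_norm (fun J => ?_) ((tendsto_add_atTop_iff_nat 1).2 hz)
    have h1 := natBeta_mul_le_one (J + 1) k
    push_cast at h1
    rw [Real.norm_eq_abs, abs_mul]
    refine (mul_le_of_le_one_right (abs_nonneg _) ?_).trans (hx' (J + 1))
    rw [abs_of_nonneg (mul_nonneg (natBeta_nonneg _ _) (by positivity))]
    linarith
  simpa using (((tendsto_const_nhds (x := (1 : ℝ))).sub hz').div_const
    ((k : ℝ) + 1 + x)).sub_const (1 / ((k : ℝ) + 1))

lemma integral_one_div_add_sub {a b : ℝ} (ha : -1 < a) (hab : a ≤ b) (k : ℕ) :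
    ∫ x in a..b, (1 / ((k : ℝ) + 1 + x) - 1 / (k + 1)) =
      Real.log (k + 1 + b) - Real.log (k + 1 + a) - (b - a) * (1 / (k + 1)) := by
  have hk : (0 : ℝ) ≤ k := Nat.cast_nonneg k
  rw [intervalIntegral.integral_sub, intervalIntegral.integral_const,
    intervalIntegral.integral_comp_add_left (fun y => 1 / y) ((k : ℝ) + 1),
    integral_one_div_of_pos (by linarith) (by linarith),
    Real.log_div (by linarith) (by linarith), smul_eq_mul]
  · refine ContinuousOn.intervalIntegrable_of_Icc hab
      (continuousOn_const.div (by fun_prop) fun x hx => ?_)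
    linarith [hx.1]
  · exact intervalIntegrable_const

lemma hasSum_integral_signedBinom_mul_natBeta {a b : ℝ} (ha : -1 < a) (hab : a ≤ b) (k : ℕ) :
    HasSum (fun j => (∫ x in a..b, signedBinom (j + 1) x) * natBeta (j + 1) k)
      (Real.log (k + 1 + b) - Real.log (k + 1 + a) - (b - a) * (1 / (k + 1))) := by
  obtain ⟨δ, hδ, M, hM, h⟩ := exists_abs_signedBinom_le ha b
  rw [← integral_one_div_add_sub ha hab]
  simp only [← intervalIntegral.integral_mul_const]
  refine intervalIntegral.hasSum_integral_of_dominated_convergence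
    (fun j _ => M * ((j : ℝ) + 1) ^ (-δ) * (1 / ((j : ℝ) + 1)))
    (fun j => ((continuous_signedBinom _).mul continuous_const).aestronglyMeasurable)
    (fun j => .of_forall fun x hx => ?_)
    (.of_forall fun x _ => summable_rpow_neg_mul_one_div hδ M)
    intervalIntegrable_const
    (.of_forall fun x hx => ?_)
  all_goals rw [Set.uIoc_of_le hab] at hx
  · exact abs_signedBinom_succ_mul_le hδ hM (h x hx.1.le hx.2) (abs_natBeta_succ_le j k)
  · exact hasSum_signedBinom_mul_natBeta (ha.trans hx.1) k

lemma summable_abs_integral_signedBinom {a b : ℝ} (ha : -1 < a) (hab : a ≤ b) :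
    Summable fun j : ℕ => |∫ x in a..b, signedBinom (j + 1) x| * (1 / ((j : ℝ) + 1)) := by
  obtain ⟨δ, hδ, M, hM, h⟩ := exists_abs_signedBinom_le ha b
  refine ((summable_rpow_neg_mul_one_div hδ M).mul_left |b - a|).of_nonneg_of_le
    (fun j => by positivity) fun j => ?_
  have hj : |(1 : ℝ) / (j + 1)| ≤ 1 / (j + 1) := by rw [abs_of_pos (by positivity)]
  have hpos : (0 : ℝ) < 1 / ((j : ℝ) + 1) := by positivity
  calc |∫ x in a..b, signedBinom (j + 1) x| * (1 / ((j : ℝ) + 1))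
      = |∫ x in a..b, signedBinom (j + 1) x * (1 / ((j : ℝ) + 1))| := by
        rw [intervalIntegral.integral_mul_const, abs_mul, abs_of_pos hpos]
    _ ≤ _ := ?_
  rw [mul_comm |b - a|, ← Real.norm_eq_abs (intervalIntegral _ _ _ _)]
  refine intervalIntegral.norm_integral_le_of_norm_le_const fun x hx => ?_
  rw [Set.uIoc_of_le hab] at hx
  exact abs_signedBinom_succ_mul_le hδ hM (h x hx.1.le hx.2) hj

/-- Truncations of the digamma integral converge to the integrated Newton series. -/
lemma tendsto_sum_log_sub {a b : ℝ} (ha : -1 < a) (hab : a ≤ b) :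
    Tendsto (fun K : ℕ => ∑ k ∈ Finset.range K,
        (Real.log (k + 1 + b) - Real.log (k + 1 + a) - (b - a) * (1 / ((k : ℝ) + 1)))) atTop
      (nhds (∑' j : ℕ, (∫ x in a..b, signedBinom (j + 1) x) * (1 / ((j : ℝ) + 1)))) := by
  set A : ℕ → ℝ := fun j => ∫ x in a..b, signedBinom (j + 1) x
  have hS := summable_abs_integral_signedBinom ha hab
  have hle : ∀ k j, |A j * natBeta j k| ≤ |A j| * (1 / ((j : ℝ) + 1)) * (1 / ((k : ℝ) + 1)) := by
    intro k j
    rw [abs_mul, abs_of_nonneg (natBeta_nonneg _ _), mul_assoc]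
    gcongr
    exact natBeta_le j k
  have hsum : ∀ k, Summable fun j => A j * natBeta j k := fun k =>
    (hS.mul_right _).of_norm_bounded (hle k)
  set I : ℕ → ℝ := fun k => ∑' j, A j * natBeta j k with hI
  have hstep : ∀ k : ℕ, Real.log (k + 1 + b) - Real.log (k + 1 + a)
      - (b - a) * (1 / ((k : ℝ) + 1)) = I k - I (k + 1) := by
    intro k
    refine (hasSum_integral_signedBinom_mul_natBeta ha hab k).unique ?_
    refine ?_
    simpa only [← mul_sub, natBeta_sub] using (hsum k).hasSum.sub (hsum (k + 1)).hasSum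
  have hI0 : Tendsto I atTop (nhds 0) := by
    have h0 := tendsto_one_div_add_atTop_nhds_zero_nat.const_mul
      (∑' j : ℕ, |A j| * (1 / ((j : ℝ) + 1)))
    rw [mul_zero] at h0
    exact squeeze_zero_norm (fun k => tsum_of_norm_bounded (hS.hasSum.mul_right _) (hle k)) h0
  have hlim := hI0.const_sub (I 0)
  simp only [hstep, Finset.sum_range_sub']
  simpa [hI, natBeta_zero_right] using hlim

lemma sum_range_log_sub (a : ℝ) (m K : ℕ) :
    ∑ k ∈ Finset.range K, (Real.log (k + 1 + (a + m)) - Real.log (k + 1 + a)) =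
      ∑ l ∈ Finset.Icc 1 m, (Real.log (K + (a + l)) - Real.log (a + l)) := by
  induction m with
  | zero => simp
  | succ m ih =>
    rw [Finset.sum_Icc_succ_top (by omega), ← ih, ← sub_eq_iff_eq_add', ← Finset.sum_sub_distrib]
    have h := Finset.sum_range_sub (fun k : ℕ => Real.log (k + (a + (m + 1 : ℕ)))) K
    simp only [Nat.cast_zero, zero_add] at h
    rw [← h]
    refine Finset.sum_congr rfl fun k _ => ?_
    push_cast
    ring_nf

lemma tendsto_log_natCast_add_sub_log (c : ℝ) :
    Tendsto (fun K : ℕ => Real.log (K + c) - Real.log K) atTop (nhds 0) := by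
  exact (Real.tendsto_log_comp_add_sub_log c).comp tendsto_natCast_atTop_atTop

lemma tendsto_sum_log_sub_eulerMascheroni (a : ℝ) (m : ℕ) :
    Tendsto (fun K : ℕ => ∑ k ∈ Finset.range K,
        (Real.log (k + 1 + (a + m)) - Real.log (k + 1 + a)
          - (a + m - a) * (1 / ((k : ℝ) + 1)))) atTop
      (nhds (-(∑ l ∈ Finset.Icc 1 m, Real.log (a + l)) - m * Real.eulerMascheroniConstant)) := by
  have h1 : Tendsto (fun K : ℕ => ∑ l ∈ Finset.Icc 1 m,
      (Real.log (K + (a + l)) - Real.log K)) atTop (nhds 0) := by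
    simpa using tendsto_finsetSum (Finset.Icc 1 m)
      fun l _ => tendsto_log_natCast_add_sub_log (a + (l : ℝ))
  have h2 := Real.tendsto_harmonic_sub_log.const_mul (m : ℝ)
  have h3 := (h1.sub_const (∑ l ∈ Finset.Icc 1 m, Real.log (a + l))).sub h2
  rw [zero_sub] at h3
  refine h3.congr fun K => ?_
  have hh : ((harmonic K : ℚ) : ℝ) = ∑ k ∈ Finset.range K, 1 / ((k : ℝ) + 1) := by
    simp [harmonic]
  rw [Finset.sum_sub_distrib (s := Finset.range K), sum_range_log_sub, ← Finset.mul_sum, ← hh,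
    Finset.sum_sub_distrib, Finset.sum_sub_distrib]
  simp only [Finset.sum_const, Nat.card_Icc, Nat.add_sub_cancel, nsmul_eq_mul]
  ring

/-- Generalization of the Fontana–Mascheroni series: for an integer `m ≥ 1` and a real
`a > −1`, the Euler–Mascheroni constant satisfies
`γ = −(1/m) Σ_{l=1}^{m} ln(a+l) − (1/m) Σ_{n=1}^∞ (−1)^n N_{n,m}(a)/n`,
the infinite series being convergent. -/
theorem eulerMascheroni_serN_series (m : ℕ) (hm : 1 ≤ m) (a : ℝ) (ha : -1 < a) :
    ∃ L : ℝ,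
      Tendsto (fun N : ℕ => ∑ n ∈ Finset.range N,
          (-1 : ℝ) ^ (n + 1) * serN (n + 1) m a / ((n : ℝ) + 1)) atTop (nhds L) ∧
      Real.eulerMascheroniConstant =
        -(1 / (m : ℝ)) * (∑ l ∈ Finset.Icc 1 m, Real.log (a + (l : ℝ)))
          - (1 / (m : ℝ)) * L := by
  have hab : a ≤ a + (m : ℝ) := le_add_of_nonneg_right (Nat.cast_nonneg m)
  have hm0 : (m : ℝ) ≠ 0 := by positivity
  have hsum : Summable fun j : ℕ =>
      (∫ x in a..(a + (m : ℝ)), signedBinom (j + 1) x) * (1 / ((j : ℝ) + 1)) :=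
    (summable_abs_integral_signedBinom ha hab).of_norm_bounded fun j => by
      rw [Real.norm_eq_abs, abs_mul, abs_of_pos (by positivity : (0 : ℝ) < 1 / ((j : ℝ) + 1))]
  have hL := tendsto_nhds_unique (tendsto_sum_log_sub ha hab)
    (tendsto_sum_log_sub_eulerMascheroni a m)
  refine ⟨_, hsum.hasSum.tendsto_sum_nat.congr fun N => Finset.sum_congr rfl fun n _ => ?_, ?_⟩
  · rw [integral_signedBinom, mul_one_div]
  · rw [hL]
    field_simp
    ring
end
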